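/- arXiv:math/0607061 — 7 statements merged into one kernel-verified Lean document; each statement's English description precedes it below -/
import Mathlib

section
/- Fix q ∈ ℂ with 0 < |q| < 1 and η ∈ ℂ with η ≠ 0. If f : ℂ → ℂ is holomorphic on ℂ∖{0} and satisfies η z f(qz) = f(z) for every z ≠ 0, then there is a constant c ∈ ℂ such that f(z) = c · ϑ(ηz) for all z ≠ 0, where ϑ(w) = Σ_{l∈ℤ} q^{l(l−1)/2} w^l is the Jacobi theta function. In other words, the space of such solutions is one-dimensional, spanned by z ↦ ϑ(ηz). -/
/-- The Jacobi theta function `ϑ(w) = Σ_{l∈ℤ} q^{l(l−1)/2} w^l`. -/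
noncomputable def jacobiThetaQ (q w : ℂ) : ℂ :=
  ∑' l : ℤ, q ^ (l * (l - 1) / 2) * w ^ l

instance jt_fact : Fact (0 < 2 * Real.pi) := ⟨Real.two_pi_pos⟩

noncomputable def jtA (f : ℂ → ℂ) (n : ℤ) (z : ℂ) : ℂ :=
  fourierCoeff (fun x : AddCircle (2 * Real.pi) => f (z * (AddCircle.toCircle x : ℂ))) n

lemma jt_rot (f : ℂ → ℂ) (n : ℤ) (z : ℂ) (y : AddCircle (2 * Real.pi)) :
    jtA f n (z * (AddCircle.toCircle y : ℂ)) = (AddCircle.toCircle y : ℂ) ^ n * jtA f n z := by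
  unfold jtA fourierCoeff
  rw [← MeasureTheory.integral_add_right_eq_self (μ := AddCircle.haarAddCircle)
    (fun t : AddCircle (2 * Real.pi) => fourier (-n) t • f (z * (AddCircle.toCircle t : ℂ))) y]
  rw [← MeasureTheory.integral_const_mul]
  congr 1
  ext t
  simp only [fourier_apply, smul_add, AddCircle.toCircle_add, Circle.coe_mul, smul_eq_mul,
    AddCircle.toCircle_zsmul, Circle.coe_zpow]
  have h : (AddCircle.toCircle y : ℂ) ≠ 0 := Circle.coe_ne_zero _
  have h2 : (AddCircle.toCircle y : ℂ) ^ n * (AddCircle.toCircle y : ℂ) ^ (-n) = 1 := by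
    rw [← zpow_add₀ h]; simp
  rw [show z * (AddCircle.toCircle y : ℂ) * (AddCircle.toCircle t : ℂ)
    = z * ((AddCircle.toCircle t : ℂ) * (AddCircle.toCircle y : ℂ)) by ring]
  linear_combination (-(AddCircle.toCircle t : ℂ) ^ (-n) * f (z * ((AddCircle.toCircle t : ℂ) * (AddCircle.toCircle y : ℂ)))) * h2

lemma jt_circle (f : ℂ → ℂ) (n : ℤ) (r : ℝ) (hr : 0 < r) :
    jtA f n r = (r : ℂ) ^ n * ((2 * Real.pi * Complex.I)⁻¹ *
      ∮ w in C(0, r), w ^ (-n - 1) * f w) := by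
  unfold jtA
  have hr' : (r : ℂ) ≠ 0 := by exact_mod_cast hr.ne'
  have hpi : (Real.pi : ℂ) ≠ 0 := by exact_mod_cast Real.pi_ne_zero
  rw [fourierCoeff_eq_intervalIntegral _ n 0, circleIntegral, zero_add,
    Complex.real_smul, ← intervalIntegral.integral_const_mul,
    ← intervalIntegral.integral_const_mul, ← intervalIntegral.integral_const_mul]
  congr 1
  ext t
  have hc : ((AddCircle.toCircle (t : AddCircle (2 * Real.pi))) : ℂ) = Complex.exp (t * Complex.I) := by
    rw [AddCircle.toCircle_apply_mk, Circle.coe_exp]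
    congr 2
    push_cast
    field_simp
  have he : Complex.exp (t * Complex.I) ≠ 0 := Complex.exp_ne_zero _
  simp only [fourier_apply, AddCircle.toCircle_zsmul, Circle.coe_zpow, hc, deriv_circleMap,
    circleMap, zero_add, smul_eq_mul, mul_zpow]
  rw [zpow_sub₀ hr', zpow_sub₀ he, zpow_neg (r : ℂ)]
  have := zpow_ne_zero n hr'
  push_cast
  field_simp

lemma jt_radius (f : ℂ → ℂ) (hf : ∀ z : ℂ, z ≠ 0 → DifferentiableAt ℂ f z) (n : ℤ) (r : ℝ)
    (hr : 0 < r) : jtA f n r = (r : ℂ) ^ n * jtA f n 1 := by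
  have key : ∀ a b : ℝ, 0 < a → a ≤ b → (∮ w in C(0, b), w ^ (-n - 1) * f w) =
      ∮ w in C(0, a), w ^ (-n - 1) * f w := by
    intro a b ha hab
    have hd : ∀ z : ℂ, z ≠ 0 → DifferentiableAt ℂ (fun w => w ^ (-n - 1) * f w) z := by
      intro z hz
      exact (differentiableAt_zpow.2 (Or.inl hz)).mul (hf z hz)
    refine Complex.circleIntegral_eq_of_differentiable_on_annulus_off_countable ha hab
      Set.countable_empty ?_ ?_
    · intro z hz
      refine (hd z ?_).continuousAt.continuousWithinAt
      rintro rfl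
      exact hz.2 (Metric.mem_ball_self ha)
    · intro z hz
      refine hd z ?_
      rintro rfl
      exact hz.1.2 (Metric.mem_closedBall_self ha.le)
  have h1 := jt_circle f n 1 one_pos
  rw [Complex.ofReal_one, one_zpow, one_mul] at h1
  rw [jt_circle f n r hr, h1]
  rcases le_total r 1 with h | h
  · rw [key r 1 hr h]
  · rw [key 1 r one_pos h]

lemma jt_coeff (f : ℂ → ℂ) (hf : ∀ z : ℂ, z ≠ 0 → DifferentiableAt ℂ f z) (n : ℤ) (z : ℂ)
    (hz : z ≠ 0) : jtA f n z = jtA f n 1 * z ^ n := by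
  have hc : ((AddCircle.toCircle ((z.arg : ℝ) : AddCircle (2 * Real.pi))) : ℂ)
      = Complex.exp (z.arg * Complex.I) := by
    rw [AddCircle.toCircle_apply_mk, Circle.coe_exp]
    have hpi : (Real.pi : ℂ) ≠ 0 := by exact_mod_cast Real.pi_ne_zero
    congr 2
    push_cast
    field_simp
  have h := jt_rot f n (‖z‖ : ℝ) ((z.arg : ℝ) : AddCircle (2 * Real.pi))
  rw [jt_radius f hf n _ (norm_pos_iff.2 hz), hc, Complex.norm_mul_exp_arg_mul_I] at h
  rw [h, mul_comm, mul_comm ((‖z‖ : ℂ) ^ n), mul_assoc, ← mul_zpow, Complex.norm_mul_exp_arg_mul_I]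

lemma jt_rec (q η : ℂ) (hq : q ≠ 0)
    (f : ℂ → ℂ) (hf : ∀ z : ℂ, z ≠ 0 → DifferentiableAt ℂ f z)
    (heq : ∀ z : ℂ, z ≠ 0 → η * z * f (q * z) = f z) (n : ℤ) :
    jtA f (n + 1) 1 = η * q ^ n * jtA f n 1 := by
  have h : jtA f (n + 1) 1 = η * jtA f n q := by
    unfold jtA fourierCoeff
    rw [← MeasureTheory.integral_const_mul]
    congr 1
    ext t
    have h : (AddCircle.toCircle t : ℂ) ≠ 0 := Circle.coe_ne_zero _
    simp only [fourier_apply, smul_eq_mul, AddCircle.toCircle_zsmul, Circle.coe_zpow, one_mul]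
    rw [← heq _ h, show -n = -(n + 1) + 1 by ring, zpow_add₀ h, zpow_one]
    ring
  rw [h, jt_coeff f hf n q hq]
  ring

lemma jt_tri (n : ℤ) : (n + 1) * (n + 1 - 1) / 2 = n * (n - 1) / 2 + n := by
  rw [show (n + 1) * (n + 1 - 1) = n * (n - 1) + n * 2 by ring,
    Int.add_mul_ediv_right _ _ (by norm_num)]

lemma jt_formula (q η : ℂ) (hq : q ≠ 0) (hη : η ≠ 0) (a : ℤ → ℂ)
    (ha : ∀ n, a (n + 1) = η * q ^ n * a n) (n : ℤ) :
    a n = a 0 * (q ^ (n * (n - 1) / 2) * η ^ n) := by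
  induction n using Int.induction_on with
  | zero => simp
  | succ i ih =>
    rw [ha, ih, jt_tri, zpow_add₀ hq, zpow_add₀ hη, zpow_one]; ring
  | pred i ih =>
    have h1 := ha (-(i : ℤ) - 1)
    have h2 := jt_tri (-(i : ℤ) - 1)
    rw [sub_add_cancel] at h1 h2
    rw [h1, h2, zpow_add₀ hq] at ih
    have h3 : η ^ (-(i : ℤ)) = η ^ (-(i : ℤ) - 1) * η := by
      rw [← zpow_add_one₀ hη, sub_add_cancel]
    rw [h3] at ih
    have h4 : η * q ^ (-(i : ℤ) - 1) ≠ 0 := mul_ne_zero hη (zpow_ne_zero _ hq)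
    apply mul_left_cancel₀ h4
    rw [ih]; ring

lemma jt_ratio (q w : ℂ) (hq1 : ‖q‖ < 1) (u : ℕ → ℂ) (h0 : ∀ n, u n ≠ 0)
    (h : ∀ n, u (n + 1) = w * q ^ n * u n) : Summable u := by
  refine summable_of_ratio_test_tendsto_lt_one (l := 0) one_pos (Filter.Eventually.of_forall h0) ?_
  have h1 : (fun n => ‖u (n + 1)‖ / ‖u n‖) = fun n => ‖w * q ^ n‖ := by
    ext n
    rw [h, norm_mul, mul_div_assoc, div_self (norm_ne_zero_iff.2 (h0 n)), mul_one]
  rw [h1]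
  have := ((tendsto_pow_atTop_nhds_zero_of_norm_lt_one hq1).const_mul w).norm
  simpa using this

lemma jt_summable (q w : ℂ) (hq : q ≠ 0) (hq1 : ‖q‖ < 1) (hw : w ≠ 0) :
    Summable (fun l : ℤ => q ^ (l * (l - 1) / 2) * w ^ l) := by
  have h0 : ∀ l : ℤ, q ^ (l * (l - 1) / 2) * w ^ l ≠ 0 := fun l =>
    mul_ne_zero (zpow_ne_zero _ hq) (zpow_ne_zero _ hw)
  refine Summable.of_nat_of_neg ?_ ?_
  · refine jt_ratio q w hq1 _ (fun n => h0 n) ?_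
    intro n
    push_cast
    rw [jt_tri, zpow_add₀ hq, zpow_add₀ hw, zpow_one, zpow_natCast]; ring
  · refine jt_ratio q (w⁻¹ * q) hq1 _ (fun n => h0 (-n)) ?_
    intro n
    have h2 := jt_tri (-(n : ℤ) - 1)
    rw [sub_add_cancel] at h2
    push_cast
    rw [show -((n : ℤ) + 1) = -(n : ℤ) - 1 by ring, h2, zpow_add₀ hq, zpow_sub₀ hw, zpow_one,
      show -(n : ℤ) - 1 = -((n + 1 : ℕ) : ℤ) by push_cast; ring, zpow_neg q, zpow_natCast, pow_succ]
    field_simp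

/-- For `0 < |q| < 1` and `η ≠ 0`, any function holomorphic on `ℂ ∖ {0}` satisfying
`η z f(qz) = f(z)` for all `z ≠ 0` is a constant multiple of `z ↦ ϑ(ηz)`. -/
theorem solution_is_multiple_of_jacobiThetaQ (q η : ℂ) (hq0 : 0 < ‖q‖) (hq1 : ‖q‖ < 1)
    (hη : η ≠ 0) (f : ℂ → ℂ) (hf : ∀ z : ℂ, z ≠ 0 → DifferentiableAt ℂ f z)
    (heq : ∀ z : ℂ, z ≠ 0 → η * z * f (q * z) = f z) :
    ∃ c : ℂ, ∀ z : ℂ, z ≠ 0 → f z = c * jacobiThetaQ q (η * z) := by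
  have hq : q ≠ 0 := norm_pos_iff.1 hq0
  refine ⟨jtA f 0 1, fun z hz => ?_⟩
  have hc : ∀ n, jtA f n z = jtA f 0 1 * (q ^ (n * (n - 1) / 2) * (η * z) ^ n) := by
    intro n
    rw [jt_coeff f hf n z hz,
      jt_formula q η hq hη (fun n => jtA f n 1) (jt_rec q η hq f hf heq) n, mul_zpow]
    ring
  have hs := jt_summable q (η * z) hq hq1 (mul_ne_zero hη hz)
  have hcont : Continuous (fun x : AddCircle (2 * Real.pi) => f (z * (AddCircle.toCircle x : ℂ))) := by
    rw [continuous_iff_continuousAt]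
    intro x
    have h1 : ContinuousAt f (z * (AddCircle.toCircle x : ℂ)) :=
      (hf _ (mul_ne_zero hz (Circle.coe_ne_zero _))).continuousAt
    have h2 : Continuous (fun x : AddCircle (2 * Real.pi) => z * (AddCircle.toCircle x : ℂ)) :=
      continuous_const.mul ((show Continuous (fun c : Circle => (c : ℂ)) from continuous_subtype_val).comp AddCircle.continuous_toCircle)
    exact ContinuousAt.comp (f := fun x : AddCircle (2 * Real.pi) => z * (AddCircle.toCircle x : ℂ))
      h1 h2.continuousAt
  have hF : ∀ n, fourierCoeff (ContinuousMap.mk _ hcont) n =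
      jtA f 0 1 * (q ^ (n * (n - 1) / 2) * (η * z) ^ n) := hc
  have hsum := has_pointwise_sum_fourier_series_of_summable (f := ContinuousMap.mk _ hcont)
    (by rw [funext hF]; exact hs.mul_left _) 0
  have hval : (ContinuousMap.mk _ hcont) (0 : AddCircle (2 * Real.pi)) = f z := by
    simp
  have hfun : (fun i => fourierCoeff (ContinuousMap.mk _ hcont) i •
      fourier i (0 : AddCircle (2 * Real.pi))) =
      fun n : ℤ => jtA f 0 1 * (q ^ (n * (n - 1) / 2) * (η * z) ^ n) := by
    funext n
    rw [hF n, fourier_eval_zero, smul_eq_mul, mul_one]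
  rw [hval, hfun] at hsum
  rw [← hsum.tsum_eq, tsum_mul_left]
  rfl
end

section
/- Fix q ∈ ℂ with 0 < |q| < 1, η ∈ ℂ with η ≠ 0, and an integer k ≥ 1. The k functions z ↦ ϑ^k_n(z,η) for n = 0, 1, …, k−1, viewed as functions on ℂ∖{0}, are linearly independent over ℂ. -/
/-- The `l`-th term of the level-`k` theta function. -/
noncomputable def thetaTerm (q η : ℂ) (k n : ℤ) (z : ℂ) (l : ℤ) : ℂ :=
  q ^ (l * n) * q ^ (k * (l * (l - 1)) / 2) * η ^ (k * l) * z ^ (k * l + n)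

/-- The level-`k` theta function `ϑ^k_n(z,η) = Σ_{l∈ℤ} q^{ln} q^{kl(l−1)/2} η^{kl} z^{kl+n}`. -/
noncomputable def theta (q η : ℂ) (k n : ℤ) (z : ℂ) : ℂ :=
  ∑' l : ℤ, thetaTerm q η k n z l

open Filter Topology MeasureTheory in
lemma aux_ratio (f : ℕ → ℂ) (C r : ℂ) (hr : ‖r‖ < 1) (hf : ∀ n, f n ≠ 0)
    (h : ∀ n, f (n + 1) = C * r ^ n * f n) : Summable f := by
  refine summable_of_ratio_test_tendsto_lt_one (l := 0) zero_lt_one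
    (Eventually.of_forall hf) ?_
  have h1 : Tendsto (fun n : ℕ => ‖C‖ * ‖r‖ ^ n) atTop (𝓝 (‖C‖ * 0)) :=
    (tendsto_pow_atTop_nhds_zero_of_lt_one (norm_nonneg _) hr).const_mul _
  rw [mul_zero] at h1
  refine h1.congr fun n => ?_
  have := norm_ne_zero_iff.mpr (hf n)
  rw [h, norm_mul, norm_mul, norm_pow]
  field_simp

lemma aux_div (k l : ℤ) : k * ((l + 1) * (l + 1 - 1)) / 2 = k * (l * (l - 1)) / 2 + k * l := by
  rw [← Int.add_mul_ediv_right _ _ (by norm_num)]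
  congr 1
  ring

lemma aux_step (q η : ℂ) (hq : q ≠ 0) (hη : η ≠ 0) (k n l : ℤ) :
    thetaTerm q η k n 1 (l + 1) = q ^ n * η ^ k * q ^ (k * l) * thetaTerm q η k n 1 l := by
  unfold thetaTerm
  rw [aux_div, show (l + 1) * n = l * n + n by ring, show k * (l + 1) = k * l + k by ring]
  simp only [zpow_add₀ hq, zpow_add₀ hη, one_zpow]
  ring

lemma aux_ne (q η : ℂ) (hq : q ≠ 0) (hη : η ≠ 0) (k n l : ℤ) :
    thetaTerm q η k n 1 l ≠ 0 := by
  unfold thetaTerm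
  simp only [one_zpow, mul_one]
  exact mul_ne_zero (mul_ne_zero (zpow_ne_zero _ hq) (zpow_ne_zero _ hq)) (zpow_ne_zero _ hη)

lemma aux_summable (q η : ℂ) (hq0 : 0 < ‖q‖) (hq1 : ‖q‖ < 1)
    (hη : η ≠ 0) (k : ℕ) (hk : 1 ≤ k) (n : ℤ) : Summable (thetaTerm q η k n 1) := by
  have hq : q ≠ 0 := norm_pos_iff.mp hq0
  have hr : ‖q ^ k‖ < 1 := by
    rw [norm_pow]; exact pow_lt_one₀ hq0.le hq1 (by omega)
  apply Summable.of_nat_of_neg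
  · refine aux_ratio _ (q ^ n * η ^ (k : ℤ)) (q ^ k) hr (fun m => aux_ne q η hq hη _ _ _) ?_
    intro m
    push_cast
    rw [aux_step q η hq hη, zpow_mul, zpow_natCast, zpow_natCast, zpow_natCast]
  · refine aux_ratio _ (q ^ (-n) * η ^ (-(k : ℤ)) * q ^ k) (q ^ k) hr
      (fun m => aux_ne q η hq hη _ _ _) ?_
    intro m
    have h := aux_step q η hq hη k n (-((m + 1 : ℕ) : ℤ))
    rw [show -((m + 1 : ℕ) : ℤ) + 1 = -(m : ℤ) by push_cast; ring] at h
    rw [h, show (k : ℤ) * -((m + 1 : ℕ) : ℤ) = -((k * (m + 1) : ℕ) : ℤ) by push_cast; ring]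
    simp only [zpow_neg, zpow_natCast, pow_mul]
    field_simp
    ring

lemma aux_term (q η : ℂ) (k n l : ℤ) (z : ℂ) :
    thetaTerm q η k n z l = thetaTerm q η k n 1 l * z ^ (k * l + n) := by
  simp [thetaTerm]

lemma aux_int (m : ℤ) : ∫ x : UnitAddCircle, (fourier m x : ℂ) ∂AddCircle.haarAddCircle =
    if m = 0 then 1 else 0 := by
  have h := (orthonormal_iff_ite.mp (orthonormal_fourier (T := 1))) 0 m
  rw [MeasureTheory.ContinuousMap.inner_toLp] at h
  simp only [fourier_zero, map_one, mul_one, one_mul] at h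
  rw [h]
  simp [eq_comm]

open MeasureTheory in
lemma aux_coeff (q η : ℂ) (hq0 : 0 < ‖q‖) (hq1 : ‖q‖ < 1)
    (hη : η ≠ 0) (k : ℕ) (hk : 1 ≤ k) (n m : Fin k) :
    Integrable (fun x : UnitAddCircle => (fourier (-(m : ℤ)) x : ℂ) *
        theta q η k (n : ℤ) (fourier 1 x : ℂ)) AddCircle.haarAddCircle ∧
    ∫ x : UnitAddCircle, (fourier (-(m : ℤ)) x : ℂ) * theta q η k (n : ℤ) (fourier 1 x : ℂ)
      ∂AddCircle.haarAddCircle = if n = m then 1 else 0 := by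
  have hs := aux_summable q η hq0 hq1 hη k hk (n : ℤ)
  have hp : ∀ (x : UnitAddCircle) (j : ℤ), (fourier 1 x : ℂ) ^ j = fourier j x := by
    intro x j
    simp [fourier_apply, AddCircle.toCircle_zsmul]
  set a := thetaTerm q η k (n : ℤ) 1 with ha
  let F : ℤ → C(UnitAddCircle, ℂ) := fun l => a l • fourier (k * l + n - m)
  have hF : Summable F := by
    apply Summable.of_norm
    simpa [F, norm_smul, fourier_norm] using hs.norm
  have hFn : Summable fun l => ‖F l‖ := by
    simpa [F, norm_smul, fourier_norm] using hs.norm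
  have hfun : ∀ x : UnitAddCircle, (fourier (-(m : ℤ)) x : ℂ) *
      theta q η k (n : ℤ) (fourier 1 x : ℂ) = ∑' l, F l x := by
    intro x
    unfold theta
    rw [← tsum_mul_left]
    congr 1; ext l
    rw [aux_term, hp]
    simp only [F, ContinuousMap.smul_apply, smul_eq_mul, ← ha]
    rw [sub_eq_add_neg, fourier_add (m := (k * l + n : ℤ))]
    ring
  simp_rw [hfun]
  have hsum : ∀ x, ∑' l, F l x = (∑' l, F l) x := fun x => (ContinuousMap.tsum_apply hF x).symm ▸ rfl
  constructor
  · simp_rw [hsum]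
    exact (∑' l, F l).continuous.integrable_of_hasCompactSupport
      (HasCompactSupport.of_compactSpace _)
  · rw [← integral_tsum_of_summable_integral_norm]
    · have : ∀ l, ∫ x, F l x ∂AddCircle.haarAddCircle = if l = 0 then (if n = m then 1 else 0) else 0 := by
        intro l
        simp only [F, ContinuousMap.smul_apply, smul_eq_mul]
        rw [integral_const_mul, aux_int]
        by_cases hl : l = 0
        · subst hl
          have : ((k : ℤ) * 0 + n - m = 0) ↔ n = m := by
            rw [Fin.ext_iff]; omega
          simp only [this]
          simp [ha, thetaTerm]
        · have : (k : ℤ) * l + n - m ≠ 0 := by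
            intro h
            have h1 := n.2
            have h2 := m.2
            rcases lt_or_gt_of_ne hl with h3 | h3
            · have : (k : ℤ) * l ≤ k * (-1) := by gcongr; omega
              omega
            · have : (k : ℤ) * 1 ≤ k * l := by gcongr; omega
              omega
          simp [this, hl]
      simp_rw [this]
      simp
    · intro l
      exact (F l).continuous.integrable_of_hasCompactSupport
        (HasCompactSupport.of_compactSpace _)
    · have : ∀ l, ∫ x, ‖F l x‖ ∂(AddCircle.haarAddCircle (T := 1)) = ‖a l‖ := by
        intro l
        have h1 : ∀ x : AddCircle (1 : ℝ), ‖F l x‖ = ‖a l‖ := by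
          intro x
          simp only [F, ContinuousMap.smul_apply, smul_eq_mul, norm_mul, fourier_apply]
          rw [Circle.norm_coe, mul_one]
        simp_rw [h1]
        simp
      simp_rw [this]
      exact hs.norm

/-- For `0 < |q| < 1`, `η ≠ 0` and `k ≥ 1`, the `k` functions `z ↦ ϑ^k_n(z,η)`,
`n = 0, …, k−1`, are linearly independent over `ℂ` as functions on `ℂ ∖ {0}`. -/
theorem theta_linearly_independent (q η : ℂ) (hq0 : 0 < ‖q‖) (hq1 : ‖q‖ < 1)
    (hη : η ≠ 0) (k : ℕ) (hk : 1 ≤ k) (c : Fin k → ℂ)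
    (hc : ∀ z : ℂ, z ≠ 0 → ∑ n : Fin k, c n * theta q η (k : ℤ) (n : ℤ) z = 0) :
    ∀ n : Fin k, c n = 0 := by
  intro m
  have h0 : ∫ x : UnitAddCircle, (∑ n : Fin k, c n * ((fourier (-(m : ℤ)) x : ℂ) *
      theta q η k (n : ℤ) (fourier 1 x : ℂ))) ∂AddCircle.haarAddCircle = 0 := by
    have : ∀ x : UnitAddCircle, (∑ n : Fin k, c n * ((fourier (-(m : ℤ)) x : ℂ) *
      theta q η k (n : ℤ) (fourier 1 x : ℂ))) = 0 := by
      intro x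
      have h := hc (fourier 1 x : ℂ) (by simp [fourier_apply])
      calc _ = (fourier (-(m : ℤ)) x : ℂ) *
            ∑ n : Fin k, c n * theta q η k (n : ℤ) (fourier 1 x : ℂ) := by
              rw [Finset.mul_sum]
              exact Finset.sum_congr rfl fun n _ => by ring
        _ = 0 := by rw [h, mul_zero]
    simp_rw [this]
    simp
  rw [MeasureTheory.integral_finsetSum _
    (fun n _ => (aux_coeff q η hq0 hq1 hη k hk n m).1.const_mul (c n))] at h0
  simp_rw [MeasureTheory.integral_const_mul, (aux_coeff q η hq0 hq1 hη k hk _ m).2] at h0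
  simpa using h0
end

section
/- Fix q ∈ ℂ with 0 < |q| < 1, η ∈ ℂ with η ≠ 0, and an integer k ≥ 1. If f : ℂ → ℂ is holomorphic on ℂ∖{0} and satisfies f(qz) = η^k z^k f(z) for every z ≠ 0, then f is identically zero on ℂ∖{0}. -/
/-- For `0 < |q| < 1`, `η ≠ 0` and `k ≥ 1`, any function holomorphic on `ℂ ∖ {0}`
satisfying `f(qz) = η^k z^k f(z)` for all `z ≠ 0` vanishes identically on `ℂ ∖ {0}`. -/
theorem negative_degree_no_sections (q η : ℂ) (hq0 : 0 < ‖q‖) (hq1 : ‖q‖ < 1)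
    (hη : η ≠ 0) (k : ℤ) (hk : 1 ≤ k) (f : ℂ → ℂ)
    (hf : ∀ z : ℂ, z ≠ 0 → DifferentiableAt ℂ f z)
    (heq : ∀ z : ℂ, z ≠ 0 → f (q * z) = η ^ k * z ^ k * f z) :
    ∀ z : ℂ, z ≠ 0 → f z = 0 := by
  have hq : q ≠ 0 := norm_pos_iff.mp hq0
  have hηn : 0 < ‖η‖ := norm_pos_iff.mpr hη
  obtain ⟨m, rfl⟩ : ∃ m : ℕ, k = m := ⟨k.toNat, by omega⟩
  have hm : m ≠ 0 := by omega
  have hnorm : ∀ z : ℂ, z ≠ 0 → ‖f (q * z)‖ = ‖η * z‖ ^ m * ‖f z‖ := by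
    intro z hz
    rw [heq z hz, zpow_natCast, zpow_natCast, ← mul_pow, norm_mul, norm_pow]
  have hcomp : IsCompact {z : ℂ | ‖q‖ ≤ ‖η * z‖ ∧ ‖η * z‖ ≤ 1} := by
    apply Metric.isCompact_of_isClosed_isBounded
    · have c : Continuous fun z : ℂ => ‖η * z‖ := by fun_prop
      exact (isClosed_le continuous_const c).inter (isClosed_le c continuous_const)
    · refine (Metric.isBounded_closedBall (x := (0 : ℂ)) (r := 1 / ‖η‖)).subset ?_
      rintro z ⟨_, h⟩
      rw [mem_closedBall_zero_iff, le_div_iff₀ hηn, mul_comm, ← norm_mul]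
      exact h
  have hne : ∀ z : ℂ, ‖q‖ ≤ ‖η * z‖ → z ≠ 0 := by
    rintro z h rfl
    simp at h
    exact hq h
  obtain ⟨z₀, hz₀, hmax⟩ := hcomp.exists_isMaxOn (f := fun z => ‖f z‖)
    ⟨η⁻¹, by simp [hη, hq1.le]⟩
    (fun z hz => ((hf z (hne z hz.1)).continuousAt.norm).continuousWithinAt)
  have hz₀' := hne z₀ hz₀.1
  have hP : ∀ n : ℕ, ∀ z : ℂ, z ≠ 0 → ‖q‖ ^ (n + 1) ≤ ‖η * z‖ → ‖η * z‖ * ‖q‖ ^ n ≤ 1 →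
      ‖f z‖ ≤ ‖f z₀‖ := by
    intro n
    induction n with
    | zero =>
      intro z _ h1 h2
      exact hmax ⟨by simpa using h1, by simpa using h2⟩
    | succ n ih =>
      intro z hz h1 h2
      rcases le_or_gt 1 ‖η * z‖ with h | h
      · have e : ‖η * (q * z)‖ = ‖η * z‖ * ‖q‖ := by simp only [norm_mul]; ring
        have hh := ih (q * z) (mul_ne_zero hq hz) (by
            rw [e, pow_succ]
            have : ‖q‖ ^ n ≤ 1 := pow_le_one₀ hq0.le hq1.le
            gcongr
            linarith) (by rw [e]; calc _ = _ := by ring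
                                 _ ≤ 1 := h2)
        rw [hnorm z hz] at hh
        have := one_le_pow₀ h (n := m)
        nlinarith [norm_nonneg (f z)]
      · rcases le_or_gt ‖q‖ ‖η * z‖ with h' | h'
        · exact hmax ⟨h', h.le⟩
        · obtain ⟨w, rfl⟩ : ∃ w, z = q * w := ⟨z / q, by field_simp⟩
          have hw : w ≠ 0 := right_ne_zero_of_mul hz
          have e : ‖η * (q * w)‖ = ‖η * w‖ * ‖q‖ := by simp only [norm_mul]; ring
          rw [e] at h' h1
          have hw1 : ‖η * w‖ ≤ 1 := by nlinarith
          have hh := ih w hw (by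
            rw [pow_succ] at h1
            exact le_of_mul_le_mul_right h1 hq0)
            (mul_le_one₀ hw1 (by positivity) (pow_le_one₀ hq0.le hq1.le))
          rw [hnorm w hw]
          have := pow_le_one₀ (norm_nonneg _) hw1 (n := m)
          nlinarith [norm_nonneg (f w)]
  have hall : ∀ z : ℂ, z ≠ 0 → ‖f z‖ ≤ ‖f z₀‖ := by
    intro z hz
    have hx : 0 < ‖η * z‖ := norm_pos_iff.mpr (mul_ne_zero hη hz)
    obtain ⟨n, hn⟩ := exists_pow_lt_of_lt_one (lt_min hx (inv_pos.mpr hx)) hq1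
    rw [lt_min_iff] at hn
    refine hP n z hz ?_ ?_
    · rw [pow_succ]
      have : 0 < ‖q‖ ^ n := by positivity
      nlinarith
    · calc _ ≤ ‖η * z‖ * ‖η * z‖⁻¹ := by gcongr; exact hn.2.le
        _ = 1 := mul_inv_cancel₀ hx.ne'
  have hconn : IsPreconnected ({0}ᶜ : Set ℂ) :=
    (isConnected_compl_singleton_of_one_lt_rank (by simp) 0).isPreconnected
  have hconst := Complex.eqOn_of_isPreconnected_of_isMaxOn_norm hconn isOpen_compl_singleton
    (fun z hz => (hf z hz).differentiableWithinAt) (c := z₀) hz₀' (fun z hz => hall z hz)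
  have h2 : (2 / η : ℂ) ≠ 0 := div_ne_zero two_ne_zero hη
  have h3 := hnorm (2 / η) h2
  rw [hconst (show q * (2 / η) ∈ ({0}ᶜ : Set ℂ) from mul_ne_zero hq h2),
    hconst (show (2 / η) ∈ ({0}ᶜ : Set ℂ) from h2), mul_div_cancel₀ _ hη] at h3
  simp only [Function.const_apply, Complex.norm_ofNat] at h3
  have h4 : (1 : ℝ) < 2 ^ m := one_lt_pow₀ (by norm_num) hm
  have h5 : ‖f z₀‖ = 0 := by nlinarith [norm_nonneg (f z₀)]
  intro z hz
  have := hall z hz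
  rw [h5] at this
  exact norm_le_zero_iff.mp this
end

section
/- Fix q ∈ ℂ with 0 < |q| < 1, and let g : ℂ → ℂ be holomorphic on ℂ∖{0}. Then there exists a function a : ℂ → ℂ, holomorphic on ℂ∖{0}, satisfying a(qz) − a(z) = g(z) for all z ≠ 0, if and only if the 0-th Laurent coefficient of g vanishes, i.e. (2πi)^{−1} ∮_{|z|=1} g(z) z^{−1} dz = 0. -/
open Complex

/-- independence of the radius -/
lemma aux_radius (h : ℂ → ℂ) {r R : ℝ} (h0 : 0 < r) (hle : r ≤ R)
    (hd : ∀ z : ℂ, r ≤ ‖z‖ → DifferentiableAt ℂ h z) :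
    (∮ z in C(0, R), h z) = ∮ z in C(0, r), h z := by
  refine Complex.circleIntegral_eq_of_differentiable_on_annulus_off_countable h0 hle
    Set.countable_empty ?_ ?_
  · intro z hz
    refine (hd z ?_).continuousAt.continuousWithinAt
    simpa using hz.2
  · intro z hz
    refine hd z ?_
    have := hz.1.2
    simp at this
    exact this.le

lemma aux_rot (q : ℂ) (a : ℂ → ℂ) (hq0 : 0 < ‖q‖) :
    (∮ z in C(0, 1), a (q * z) * z⁻¹) = ∮ z in C(0, ‖q‖), a z * z⁻¹ := by
  have key : ∀ (b : ℂ → ℂ) (R : ℝ), 0 < R → (∮ z in C(0, R), b z * z⁻¹)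
      = ∫ θ in (0:ℝ)..2 * Real.pi, I * b (circleMap 0 R θ) := by
    intro b R hR
    unfold circleIntegral
    congr 1
    ext θ
    have : circleMap 0 R θ ≠ 0 := circleMap_ne_center hR.ne'
    simp only [deriv_circleMap, smul_eq_mul]
    field_simp
  rw [key (fun z => a (q * z)) 1 one_pos, key a _ hq0]
  have h1 : ∀ θ : ℝ, q * circleMap 0 1 θ = circleMap 0 ‖q‖ (θ + q.arg) := by
    intro θ
    conv_lhs => rw [← Complex.norm_mul_exp_arg_mul_I q]
    simp only [circleMap, ofReal_add, add_mul, Complex.exp_add]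
    push_cast
    ring
  simp only [h1]
  rw [intervalIntegral.integral_comp_add_right (fun θ => I * a (circleMap 0 ‖q‖ θ)) q.arg]
  have hp : Function.Periodic (fun θ => I * a (circleMap 0 ‖q‖ θ)) (2 * Real.pi) := by
    intro θ
    simp only [periodic_circleMap 0 ‖q‖ θ]
  have := hp.intervalIntegral_add_eq q.arg 0
  rw [zero_add] at this
  rw [zero_add, add_comm, this]

/-- solving `S(z) - S(qz) = F(z)` for entire `F` with `F 0 = 0` -/
lemma aux_sum (q : ℂ) (hq1 : ‖q‖ < 1) (F : ℂ → ℂ) (hF : Differentiable ℂ F) (hF0 : F 0 = 0) :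
    ∃ S : ℂ → ℂ, Differentiable ℂ S ∧ ∀ z, S z - S (q * z) = F z := by
  have hds : Continuous (dslope F 0) := by
    have := (Complex.differentiableOn_dslope (f := F) (c := 0) (s := Set.univ)
      Filter.univ_mem).2 hF.differentiableOn
    exact continuousOn_univ.1 this.continuousOn
  have hFd : ∀ z, F z = z * dslope F 0 z := by
    intro z
    have := sub_smul_dslope F 0 z
    simp [hF0] at this
    exact this.symm
  have hb : ∀ R : ℝ, ∃ C : ℝ, ∀ (n : ℕ) (z : ℂ), ‖z‖ ≤ R → ‖F (q ^ n * z)‖ ≤ ‖q‖ ^ n * C := by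
    intro R
    obtain ⟨C, hC⟩ := (isCompact_closedBall (0:ℂ) R).exists_bound_of_continuousOn hds.continuousOn
    refine ⟨R * C, fun n z hz => ?_⟩
    have hR : 0 ≤ R := (norm_nonneg z).trans hz
    have hn : ‖q‖ ^ n ≤ 1 := pow_le_one₀ (norm_nonneg _) hq1.le
    have h1 : ‖q ^ n * z‖ ≤ ‖q‖ ^ n * R := by
      rw [norm_mul, norm_pow]
      gcongr
    have h2 : ‖dslope F 0 (q ^ n * z)‖ ≤ C := by
      refine hC _ ?_
      rw [mem_closedBall_zero_iff]
      exact h1.trans (mul_le_of_le_one_left hR hn)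
    rw [hFd, norm_mul, ← mul_assoc]
    gcongr
  have hgeo : Summable (fun n : ℕ => ‖q‖ ^ n) := summable_geometric_of_lt_one (norm_nonneg _) hq1
  refine ⟨fun z => ∑' n : ℕ, F (q ^ n * z), ?_, ?_⟩
  · intro z
    obtain ⟨C, hC⟩ := hb (‖z‖ + 1)
    have := Complex.differentiableOn_tsum_of_summable_norm (F := fun (n : ℕ) z => F (q ^ n * z))
      (U := Metric.ball 0 (‖z‖ + 1)) (hgeo.mul_right C)
      (fun n => (hF.comp (differentiable_id.const_mul (q ^ n))).differentiableOn)
      Metric.isOpen_ball (fun n w hw => hC n w (by simpa using (mem_ball_zero_iff.1 hw).le))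
    exact this.differentiableAt (Metric.isOpen_ball.mem_nhds (by simp))
  · intro z
    obtain ⟨C, hC⟩ := hb ‖z‖
    have hs : Summable (fun n : ℕ => F (q ^ n * z)) :=
      Summable.of_norm_bounded (hgeo.mul_right C) (fun n => hC n z le_rfl)
    have := hs.tsum_eq_zero_add
    simp only [this, pow_succ, mul_assoc]
    simp

lemma aux_laurent (g : ℂ → ℂ) (hg : ∀ z : ℂ, z ≠ 0 → DifferentiableAt ℂ g z) :
    ∃ P N : ℂ → ℂ, Differentiable ℂ P ∧ Differentiable ℂ N ∧ N 0 = 0 ∧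
      P 0 = (2 * (Real.pi : ℂ) * Complex.I)⁻¹ * (∮ z in C(0, 1), g z * z⁻¹) ∧
      ∀ z, z ≠ 0 → g z = P z + N z⁻¹ := by
  set K : ℝ → ℂ → ℂ := fun R w => (2 * (Real.pi : ℂ) * I)⁻¹ • ∮ z in C(0, R), (z - w)⁻¹ • g z
    with hK
  have hci : ∀ R : ℝ, 0 < R → ContinuousOn g (Metric.sphere 0 R) := by
    intro R hR z hz
    refine (hg z ?_).continuousAt.continuousWithinAt
    rintro rfl
    simp at hz
    exact hR.ne hz
  have hpi : (2 * (Real.pi : ℂ) * I) ≠ 0 := Complex.two_pi_I_ne_zero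
  have hKd : ∀ (R : ℝ) (w : ℂ), ‖w‖ < R → DifferentiableAt ℂ (K R) w := by
    intro R w hw
    have hR : 0 < R := (norm_nonneg w).trans_lt hw
    lift R to NNReal using hR.le
    have := hasFPowerSeriesOn_cauchy_integral (f := g) (c := 0) (R := R)
      ((hci R hR).circleIntegrable hR.le) (by exact_mod_cast hR)
    refine (this.analyticAt_of_mem ?_).differentiableAt
    simpa [Metric.eball_coe] using hw
  have hKr : ∀ (r R : ℝ) (w : ℂ), ‖w‖ < r → r ≤ R → K R w = K r w := by
    intro r R w hw hrR
    have hr : 0 < r := (norm_nonneg w).trans_lt hw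
    simp only [hK]
    congr 1
    refine aux_radius _ hr hrR (fun z hz => ?_)
    have h1 : z ≠ 0 := norm_pos_iff.1 (hr.trans_le hz)
    have h2 : z - w ≠ 0 := by
      intro h
      rw [sub_eq_zero] at h
      subst h
      linarith
    exact ((differentiableAt_id.sub_const w).inv h2).smul (hg z h1)
  set P : ℂ → ℂ := fun w => K (‖w‖ + 1) w with hP
  have hPK : ∀ (R : ℝ) (w : ℂ), ‖w‖ < R → P w = K R w := by
    intro R w hw
    rcases le_total R (‖w‖ + 1) with h | h
    · exact hKr _ _ _ hw h
    · exact (hKr _ _ _ (by linarith) h).symm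
  have hPd : Differentiable ℂ P := by
    intro w
    refine (hKd (‖w‖ + 1) w (by linarith)).congr_of_eventuallyEq ?_
    have : Metric.ball (0:ℂ) (‖w‖ + 1) ∈ nhds w := Metric.isOpen_ball.mem_nhds (by simp)
    filter_upwards [this] with z hz
    exact hPK _ _ (by simpa using hz)
  -- Cauchy formula in the annulus
  have hcauchy : ∀ (r : ℝ) (w : ℂ), 0 < r → r < ‖w‖ → P w = g w + K r w := by
    intro r w hr hw
    have hw0 : w ≠ 0 := norm_pos_iff.1 (hr.trans hw)
    set R := ‖w‖ + 1 with hR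
    have hR0 : 0 < R := by positivity
    have hds : ∀ z : ℂ, z ≠ 0 → DifferentiableAt ℂ (dslope g w) z := by
      have hop : IsOpen ({0}ᶜ : Set ℂ) := isOpen_compl_singleton
      have := (Complex.differentiableOn_dslope (f := g) (c := w) (s := {0}ᶜ)
        (hop.mem_nhds hw0)).2 (fun z hz => (hg z hz).differentiableWithinAt)
      intro z hz
      exact this.differentiableAt (hop.mem_nhds hz)
    have h1 := aux_radius (dslope g w) hr (hw.le.trans (by linarith) : r ≤ R)
      (fun z hz => hds z (norm_pos_iff.1 (hr.trans_le hz)))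
    have h2 : ∀ ρ : ℝ, 0 < ρ → ρ ≠ ‖w‖ → (∮ z in C(0, ρ), dslope g w z) =
        (∮ z in C(0, ρ), (z - w)⁻¹ • g z) - g w * ∮ z in C(0, ρ), (z - w)⁻¹ := by
      intro ρ hρ hne
      have hzw : ∀ z ∈ Metric.sphere (0:ℂ) ρ, z - w ≠ 0 := by
        intro z hz h
        rw [sub_eq_zero] at h
        subst h
        simp at hz
        exact hne hz.symm
      have hinv : ContinuousOn (fun z : ℂ => (z - w)⁻¹) (Metric.sphere (0:ℂ) ρ) :=
        (continuousOn_id.sub continuousOn_const).inv₀ hzw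
      rw [← circleIntegral.integral_const_mul, ← circleIntegral.integral_sub]
      · refine circleIntegral.integral_congr hρ.le (fun z hz => ?_)
        have : z ≠ w := sub_ne_zero.1 (hzw z hz)
        simp only [dslope_of_ne g this, slope_def_field, smul_eq_mul]
        field_simp
      · exact (hinv.smul (hci ρ hρ)).circleIntegrable hρ.le
      · exact (continuousOn_const.mul hinv).circleIntegrable hρ.le
    rw [h2 R hR0 (by simp [hR]), h2 r hr hw.ne,
      circleIntegral.integral_sub_inv_of_mem_ball (by simp [hR])] at h1
    have h3 : (∮ z in C(0, r), (z - w)⁻¹) = 0 := by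
      have hne : ∀ z : ℂ, ‖z‖ ≤ r → z - w ≠ 0 := by
        intro z hz h
        rw [sub_eq_zero] at h
        subst h
        linarith
      have hd : ∀ z : ℂ, ‖z‖ ≤ r → DifferentiableAt ℂ (fun z : ℂ => (z - w)⁻¹) z :=
        fun z hz => (differentiableAt_id.sub_const w).inv (hne z hz)
      refine Complex.circleIntegral_eq_zero_of_differentiable_on_off_countable hr.le
        Set.countable_empty (fun z hz => (hd z ?_).continuousAt.continuousWithinAt)
        (fun z hz => hd z ?_)
      · simpa using hz
      · have := hz.1
        simp at this
        exact this.le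
    rw [h3, mul_zero, sub_zero, sub_eq_iff_eq_add] at h1
    rw [hPK R w (by simp [hR])]
    simp only [hK]
    rw [h1, smul_add]
    simp only [smul_eq_mul]
    field_simp
    ring
  obtain ⟨C, hC⟩ := (isCompact_sphere (0:ℂ) 1).exists_bound_of_continuousOn (hci 1 one_pos)
  have hKb : ∀ w : ℂ, 1 < ‖w‖ → ‖K 1 w‖ ≤ 1 * ((‖w‖ - 1)⁻¹ * C) := by
    intro w hw
    refine circleIntegral.norm_two_pi_i_inv_smul_integral_le_of_norm_le_const zero_le_one ?_
    intro z hz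
    rw [norm_smul, norm_inv]
    have h1 : ‖w‖ - 1 ≤ ‖z - w‖ := by
      have := norm_sub_norm_le w z
      rw [norm_sub_rev] at this
      simp at hz
      linarith
    have h0 : 0 < ‖w‖ - 1 := by linarith
    exact mul_le_mul (inv_anti₀ h0 h1) (hC z hz) (norm_nonneg _) (inv_nonneg.2 h0.le)
  set N : ℂ → ℂ := fun u => if u = 0 then 0 else g u⁻¹ - P u⁻¹ with hN
  have hNd0 : ∀ u : ℂ, u ≠ 0 → DifferentiableAt ℂ N u := by
    intro u hu
    have h1 : DifferentiableAt ℂ (fun u : ℂ => g u⁻¹ - P u⁻¹) u :=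
      ((hg _ (inv_ne_zero hu)).comp u (differentiableAt_inv hu)).sub
        ((hPd _).comp u (differentiableAt_inv hu))
    refine h1.congr_of_eventuallyEq ?_
    filter_upwards [isOpen_compl_singleton.mem_nhds (show u ∈ ({0}ᶜ : Set ℂ) from hu)] with v hv
    simp only [hN]
    rw [if_neg (show ¬ v = 0 from hv)]
  have hNc : ContinuousAt N 0 := by
    rw [continuousAt_iff_punctured_nhds]
    have hN0 : N 0 = 0 := by simp [hN]
    rw [hN0]
    have hinf : Filter.Tendsto (fun u : ℂ => ‖u⁻¹‖) (nhdsWithin 0 {0}ᶜ) Filter.atTop :=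
      tendsto_norm_cobounded_atTop.comp Filter.tendsto_inv₀_nhdsNE_zero
    have hlim : Filter.Tendsto (fun u : ℂ => 1 * ((‖u⁻¹‖ - 1)⁻¹ * C)) (nhdsWithin 0 {0}ᶜ)
        (nhds 0) := by
      have := ((tendsto_inv_atTop_zero.comp
        (Filter.tendsto_atTop_add_const_right _ (-1) hinf)).mul_const C).const_mul 1
      simpa [sub_eq_add_neg, Function.comp_def] using this
    refine squeeze_zero_norm' ?_ hlim
    filter_upwards [hinf.eventually_gt_atTop 1, self_mem_nhdsWithin] with u hu hu0
    have hu0' : u ≠ 0 := hu0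
    have : N u = - K 1 u⁻¹ := by
      simp only [hN]
      rw [if_neg hu0', hcauchy 1 u⁻¹ one_pos hu]
      ring
    rw [this, norm_neg]
    exact hKb _ hu
  refine ⟨P, N, hPd, ?_, by simp [hN], ?_, ?_⟩
  · intro u
    by_cases hu : u = 0
    · subst hu
      refine (Complex.analyticAt_of_differentiable_on_punctured_nhds_of_continuousAt
        ?_ hNc).differentiableAt
      filter_upwards [self_mem_nhdsWithin] with u hu
      exact hNd0 u hu
    · exact hNd0 u hu
  · rw [hPK 1 0 (by simp)]
    simp only [hK, sub_zero, smul_eq_mul]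
    congr 2
    ext z
    ring
  · intro z hz
    simp [hN, hz]

/-- For `0 < |q| < 1` and `g` holomorphic on `ℂ ∖ {0}`, the equation `a(qz) − a(z) = g(z)`
has a solution `a` holomorphic on `ℂ ∖ {0}` iff the 0-th Laurent coefficient
`(2πi)⁻¹ ∮_{|z|=1} g(z) z⁻¹ dz` of `g` vanishes. -/
theorem coboundary_iff_constant_coeff_zero (q : ℂ) (hq0 : 0 < ‖q‖) (hq1 : ‖q‖ < 1)
    (g : ℂ → ℂ) (hg : ∀ z : ℂ, z ≠ 0 → DifferentiableAt ℂ g z) :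
    (∃ a : ℂ → ℂ, (∀ z : ℂ, z ≠ 0 → DifferentiableAt ℂ a z) ∧
      ∀ z : ℂ, z ≠ 0 → a (q * z) - a z = g z) ↔
    (2 * (Real.pi : ℂ) * Complex.I)⁻¹ * (∮ z in C(0, 1), g z * z⁻¹) = 0 := by
  have hq : q ≠ 0 := norm_pos_iff.1 hq0
  constructor
  · rintro ⟨a, ha, hag⟩
    have hs : ∀ z ∈ Metric.sphere (0:ℂ) 1, z ≠ 0 := by
      rintro z hz rfl
      simp at hz
    have h1 : (∮ z in C(0, 1), g z * z⁻¹) =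
        (∮ z in C(0, 1), a (q * z) * z⁻¹) - ∮ z in C(0, 1), a z * z⁻¹ := by
      rw [← circleIntegral.integral_sub]
      · refine circleIntegral.integral_congr zero_le_one (fun z hz => ?_)
        simp only [← hag z (hs z hz)]
        ring
      · refine ContinuousOn.circleIntegrable zero_le_one (fun z hz => ?_)
        have hz := hs z hz
        have : DifferentiableAt ℂ (fun z => a (q * z)) z :=
          DifferentiableAt.comp z (ha (q * z) (mul_ne_zero hq hz))
            (differentiableAt_id.const_mul q)
        exact (this.mul (differentiableAt_inv hz)).continuousAt.continuousWithinAt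
      · refine ContinuousOn.circleIntegrable zero_le_one (fun z hz => ?_)
        have hz := hs z hz
        exact ((ha z hz).mul (differentiableAt_inv hz)).continuousAt.continuousWithinAt
    have h2 : (∮ z in C(0, 1), a z * z⁻¹) = ∮ z in C(0, ‖q‖), a z * z⁻¹ := by
      refine aux_radius _ hq0 hq1.le (fun z hz => ?_)
      have hz : z ≠ 0 := norm_pos_iff.1 (hq0.trans_le hz)
      exact (ha z hz).mul (differentiableAt_inv hz)
    rw [h1, aux_rot q a hq0, h2, sub_self, mul_zero]
  · intro h
    obtain ⟨P, N, hP, hN, hN0, hP0, hPN⟩ := aux_laurent g hg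
    obtain ⟨S, hS, hSP⟩ := aux_sum q hq1 P hP (hP0.trans h)
    obtain ⟨T, hT, hTN⟩ := aux_sum q hq1 N hN hN0
    refine ⟨fun z => T (q * z⁻¹) - S z, fun z hz => ?_, fun z hz => ?_⟩
    · have : DifferentiableAt ℂ (fun z : ℂ => T (q * z⁻¹)) z :=
        DifferentiableAt.comp z (hT _) ((differentiableAt_inv hz).const_mul q)
      exact this.sub (hS z)
    · have e : q * (q * z)⁻¹ = z⁻¹ := by field_simp
      simp only [e]
      rw [hPN z hz, ← hSP z, ← hTN z⁻¹]
      ring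
end

section
/- Fix q ∈ ℂ with 0 < |q| < 1, η ∈ ℂ with η ≠ 0, and an integer k ≥ 1. For every function f : ℂ → ℂ holomorphic on ℂ∖{0} there exist unique scalars c_0, …, c_{k−1} ∈ ℂ and a unique function g : ℂ → ℂ holomorphic on ℂ∖{0} such that f(z) = Σ_{n=0}^{k−1} c_n z^n + η^{−k} z^{−k} g(qz) − g(z) for all z ≠ 0. In particular, the cokernel of the operator g ↦ (z ↦ η^{−k} z^{−k} g(qz) − g(z)) on holomorphic functions on ℂ∖{0} is a k-dimensional ℂ-vector space with basis the classes [1], [z], …, [z^{k−1}]. -/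
open Complex MeasureTheory Set Filter Topology

def EntSeq (a : ℕ → ℂ) : Prop := ∀ R : ℝ, 0 < R → ∃ C : ℝ, ∀ n, ‖a n‖ * R ^ n ≤ C

def recP (l q : ℂ) (k : ℕ) : ℕ → ℕ → ℂ
  | 0, _ => 1
  | j+1, n => l * q ^ n * recP l q k j (n + k)

theorem recP_le (l q : ℂ) (hq : ‖q‖ ≤ 1) (k j : ℕ) : ∀ n, ‖recP l q k j n‖ ≤ ‖l‖ ^ j := by
  induction j with
  | zero => intro n; simp [recP]
  | succ j ih =>
    intro n
    simp only [recP, norm_mul, norm_pow]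
    have h1 : ‖q‖ ^ n ≤ 1 := pow_le_one₀ (norm_nonneg _) hq
    calc ‖l‖ * ‖q‖ ^ n * ‖recP l q k j (n + k)‖ ≤ ‖l‖ * 1 * ‖l‖ ^ j := by
          gcongr; exact ih _
      _ = _ := by ring

theorem ent_key (l q : ℂ) (hq : ‖q‖ ≤ 1) (k : ℕ) (hk : 1 ≤ k) (a : ℕ → ℂ) (ha : EntSeq a)
    (R0 : ℝ) (h0 : 0 < R0) : ∃ R C : ℝ, R0 ≤ R ∧ 0 ≤ C ∧ ∀ n j,
      ‖recP l q k j n * a (n + j * k)‖ * R ^ n ≤ C * (1 / 2) ^ j := by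
  set R := R0 + 1 + 2 * ‖l‖ with hR
  have hl := norm_nonneg l
  have hR1 : 1 ≤ R := by linarith
  obtain ⟨C, hC⟩ := ha R (by linarith)
  have hC0 : 0 ≤ C := le_trans (by positivity) (hC 0)
  refine ⟨R, C, by linarith, hC0, fun n j => ?_⟩
  have h1 := hC (n + j * k)
  have h2 := recP_le l q hq k j n
  have h3 : R ≤ R ^ k := le_self_pow₀ hR1 (by omega)
  have h4 : (2 * ‖l‖) ^ j ≤ (R ^ k) ^ j := by
    gcongr; linarith
  rw [norm_mul]
  have hA := norm_nonneg (a (n + j * k))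
  have hRn : 0 ≤ R ^ n := by positivity
  have h5 : ‖l‖ ^ j = (2 * ‖l‖) ^ j * (1/2) ^ j := by rw [← mul_pow]; congr 1; ring
  calc ‖recP l q k j n‖ * ‖a (n + j * k)‖ * R ^ n
      ≤ ((R ^ k) ^ j * (1/2) ^ j) * ‖a (n + j * k)‖ * R ^ n := by
        gcongr
        rw [h5] at h2
        exact h2.trans (by gcongr)
    _ = (‖a (n + j * k)‖ * R ^ (n + j * k)) * (1/2)^j := by
        rw [pow_add, mul_comm j k, pow_mul]; ring
    _ ≤ _ := by gcongr

theorem ent_exists (l q : ℂ) (hq : ‖q‖ ≤ 1) (k : ℕ) (hk : 1 ≤ k) (a : ℕ → ℂ) (ha : EntSeq a) :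
    ∃ G : ℕ → ℂ, EntSeq G ∧ ∀ n, G n = a n + l * q ^ n * G (n + k) := by
  have hgeo : Summable (fun j : ℕ => ((1:ℝ)/2) ^ j) := summable_geometric_two
  have hs : ∀ n, Summable (fun j => recP l q k j n * a (n + j * k)) := by
    intro n
    obtain ⟨R, C, hR, hC, h⟩ := ent_key l q hq k hk a ha 1 one_pos
    refine Summable.of_norm_bounded (hgeo.mul_left C) (fun j => ?_)
    refine le_trans ?_ (h n j)
    exact le_mul_of_one_le_right (norm_nonneg _) (one_le_pow₀ hR)
  refine ⟨fun n => ∑' j, recP l q k j n * a (n + j * k), ?_, ?_⟩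
  · intro R0 h0
    obtain ⟨R, C, hR, hC, h⟩ := ent_key l q hq k hk a ha R0 h0
    have hRp : 0 < R := lt_of_lt_of_le h0 hR
    refine ⟨C * 2, fun n => ?_⟩
    have h1 : ‖∑' j, recP l q k j n * a (n + j * k)‖ ≤ C / R ^ n * 2 := by
      have := hasSum_geometric_two.mul_left (C / R ^ n)
      refine tsum_of_norm_bounded this (fun j => ?_)
      have := h n j
      rw [div_mul_eq_mul_div, le_div_iff₀ (by positivity)]
      exact this
    calc _ ≤ (C / R ^ n * 2) * R ^ n := by gcongr
      _ = C * 2 := by field_simp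
  · intro n
    simp only
    rw [(hs n).tsum_eq_zero_add, ← tsum_mul_left]
    congr 1
    · simp [recP]
    · refine tsum_congr fun j => ?_
      simp only [recP]
      rw [show n + (j+1) * k = n + k + j * k by ring]
      ring

theorem ent_unique (l q : ℂ) (hq : ‖q‖ ≤ 1) (k : ℕ) (hk : 1 ≤ k) (a : ℕ → ℂ) (ha : EntSeq a)
    (h : ∀ n, a n = l * q ^ n * a (n + k)) (n : ℕ) : a n = 0 := by
  obtain ⟨R, C, hR, hC, hb⟩ := ent_key l q hq k hk a ha 1 one_pos
  have h1 : ∀ j n, a n = recP l q k j n * a (n + j * k) := by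
    intro j
    induction j with
    | zero => intro n; simp [recP]
    | succ j ih =>
      intro n
      rw [h n, ih (n + k)]
      simp only [recP]
      rw [show n + (j+1) * k = n + k + j * k by ring]
      ring
  have h2 : ∀ j : ℕ, ‖a n‖ ≤ C * (1/2)^j := by
    intro j
    refine le_trans ?_ (hb n j)
    rw [← h1 j n]
    exact le_mul_of_one_le_right (norm_nonneg _) (one_le_pow₀ hR)
  have h3 : Tendsto (fun j : ℕ => C * (1/2:ℝ)^j) atTop (𝓝 (C * 0)) :=
    (tendsto_pow_atTop_nhds_zero_of_lt_one (by norm_num) (by norm_num)).const_mul C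
  have := ge_of_tendsto' h3 h2
  rw [mul_zero] at this
  exact norm_le_zero_iff.mp this

/-- Two-sided: Laurent sequences. -/
def LauSeq (a : ℤ → ℂ) : Prop := ∀ R : ℝ, 0 < R → ∃ C : ℝ, ∀ n, ‖a n‖ * R ^ n ≤ C

theorem LauSeq.summable {a : ℤ → ℂ} (ha : LauSeq a) (r : ℝ) (hr : 0 < r) :
    Summable (fun n : ℤ => ‖a n‖ * r ^ n) := by
  obtain ⟨C1, h1⟩ := ha (2 * r) (by positivity)
  obtain ⟨C2, h2⟩ := ha (r / 2) (by positivity)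
  refine Summable.of_nat_of_neg ?_ ?_
  · refine Summable.of_nonneg_of_le (fun n => by positivity) (fun n => ?_)
      (summable_geometric_two.mul_left C1)
    have := h1 n
    rw [mul_zpow] at this
    simp only [zpow_natCast] at this ⊢
    calc ‖a n‖ * r ^ n = (‖a n‖ * (2 ^ n * r ^ n)) * (1/2)^n := by
          rw [one_div, inv_pow]; field_simp
      _ ≤ _ := by gcongr
  · refine Summable.of_nonneg_of_le (fun n => by positivity) (fun n => ?_)
      (summable_geometric_two.mul_left C2)
    have := h2 (-n)
    rw [div_zpow] at this
    simp only [zpow_natCast, zpow_neg] at this ⊢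
    calc ‖a (-n)‖ * (r ^ n)⁻¹ = (‖a (-n)‖ * ((r ^ n)⁻¹ / (2^n)⁻¹)) * (1/2)^n := by
          rw [one_div, inv_pow]; field_simp
      _ ≤ _ := by gcongr

theorem LauSeq.hasSum {a : ℤ → ℂ} (ha : LauSeq a) (z : ℂ) (hz : z ≠ 0) :
    HasSum (fun n : ℤ => a n * z ^ n) (∑' n : ℤ, a n * z ^ n) := by
  refine (Summable.of_norm ?_).hasSum
  simpa using ha.summable ‖z‖ (by simpa using hz)

theorem LauSeq.differentiableAt {a : ℤ → ℂ} (ha : LauSeq a) (z : ℂ) (hz : z ≠ 0) :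
    DifferentiableAt ℂ (fun z : ℂ => ∑' n : ℤ, a n * z ^ n) z := by
  have hzp : 0 < ‖z‖ := by simpa using hz
  set U : Set ℂ := {w | ‖z‖ / 2 < ‖w‖ ∧ ‖w‖ < 2 * ‖z‖} with hU
  have hUo : IsOpen U := (isOpen_lt continuous_const continuous_norm).inter
    (isOpen_lt continuous_norm continuous_const)
  have h0 : ∀ w ∈ U, w ≠ 0 := by
    rintro w ⟨h1, h2⟩ rfl
    simp at h1; linarith
  have hd := differentiableOn_tsum_of_summable_norm (F := fun (n : ℤ) (w : ℂ) => a n * w ^ n)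
    (U := U)
    ((ha.summable (‖z‖/2) (by positivity)).add (ha.summable (2 * ‖z‖) (by positivity)))
    (fun n w hw => by
      refine ((differentiableAt_zpow.2 (Or.inl (h0 w hw))).const_mul _).differentiableWithinAt)
    hUo (fun n w hw => by
      rw [norm_mul, norm_zpow, ← mul_add]
      gcongr
      have hwp : 0 < ‖w‖ := by simpa using h0 w hw
      rcases le_or_gt 0 n with hn | hn
      · have : ‖w‖ ^ n ≤ (2 * ‖z‖) ^ n := zpow_le_zpow_left₀ hn hwp.le hw.2.le
        have h2 : 0 ≤ (‖z‖/2) ^ n := by positivity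
        linarith
      · have : ‖w‖ ^ n ≤ (‖z‖/2) ^ n := by
          obtain ⟨m, rfl⟩ : ∃ m : ℕ, n = -(m:ℤ) := ⟨n.natAbs, by omega⟩
          rw [zpow_neg, zpow_neg, zpow_natCast, zpow_natCast]
          have := hw.1.le
          gcongr
        have h2 : 0 ≤ (2 * ‖z‖) ^ n := by positivity
        linarith)
  exact hd.differentiableAt (hUo.mem_nhds ⟨by linarith, by linarith⟩)

theorem laurent_unique (a : ℤ → ℂ) (ha : LauSeq a)
    (h : ∀ z : ℂ, z ≠ 0 → HasSum (fun n : ℤ => a n * z ^ n) 0) (m : ℤ) : a m = 0 := by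
  have : Fact (0 < (1:ℝ)) := ⟨one_pos⟩
  have hs : Summable (fun n : ℤ => a n • (fourier n : C(AddCircle (1:ℝ), ℂ))) := by
    refine Summable.of_norm ?_
    simp_rw [norm_smul, fourier_norm, mul_one]
    simpa using ha.summable 1 one_pos
  have h0 : (∑' n : ℤ, a n • (fourier n : C(AddCircle (1:ℝ), ℂ))) = 0 := by
    ext x
    have h1 := (ContinuousMap.evalCLM ℂ x).hasSum hs.hasSum
    have h2 := h (AddCircle.toCircle x) (by simp)
    have h3 : (fun n : ℤ => a n * (AddCircle.toCircle x : ℂ) ^ n) =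
        (fun b => (ContinuousMap.evalCLM ℂ x) (a b • (fourier b : C(AddCircle (1:ℝ), ℂ)))) := by
      funext n
      simp [fourier_apply, AddCircle.toCircle_zsmul]
    rw [h3] at h2
    exact h1.unique h2
  have h1 := hs.hasSum
  rw [h0] at h1
  have h2 := (ContinuousMap.toLp (E := ℂ) 2 (@AddCircle.haarAddCircle 1 _) ℂ).hasSum h1
  have h3 := (innerSL ℂ (fourierLp (T := 1) 2 m)).hasSum h2
  have ho := orthonormal_iff_ite.1 (@orthonormal_fourier 1 _)
  have h4 : (fun n : ℤ => (innerSL ℂ (fourierLp (T := 1) 2 m))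
      ((ContinuousMap.toLp (E := ℂ) 2 (@AddCircle.haarAddCircle 1 _) ℂ)
        (a n • (fourier n : C(AddCircle (1:ℝ), ℂ))))) = fun n => if n = m then a m else 0 := by
    funext n
    have := ho m n
    rw [map_smul, map_smul, innerSL_apply_apply]
    change a n • inner ℂ (fourierLp 2 m) (fourierLp 2 n) = _
    rw [this]
    by_cases hnm : n = m
    · subst hnm; simp
    · simp [hnm, Ne.symm hnm]
  have h5 := h3
  simp only [map_zero] at h5
  have h6 : HasSum (fun n : ℤ => if n = m then a m else 0) 0 := by
    rw [← h4]; exact h5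
  exact (hasSum_ite_eq m (a m)).unique h6

theorem laurent_exists (f : ℂ → ℂ) (hf : ∀ z : ℂ, z ≠ 0 → DifferentiableAt ℂ f z) :
    ∃ a : ℤ → ℂ, LauSeq a ∧ ∀ z : ℂ, z ≠ 0 → HasSum (fun n : ℤ => a n * z ^ n) (f z) := by
  set A : ℝ → ℤ → ℂ := fun R n =>
    (2 * Real.pi * I : ℂ)⁻¹ • ∮ w in C(0, R), w ^ (-n - 1) * f w with hA
  have hdf : ∀ n : ℤ, ∀ w : ℂ, w ≠ 0 → DifferentiableAt ℂ (fun w => w ^ (-n - 1) * f w) w :=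
    fun n w hw => (differentiableAt_zpow.2 (Or.inl hw)).mul (hf w hw)
  have hle : ∀ n : ℤ, ∀ r R : ℝ, 0 < r → r ≤ R → A R n = A r n := by
    intro n r R hr hrR
    simp only [hA]
    congr 1
    refine circleIntegral_eq_of_differentiable_on_annulus_off_countable hr hrR
      (s := ∅) countable_empty (fun w hw => ?_) (fun w hw => ?_)
    · refine (hdf n w ?_).continuousAt.continuousWithinAt
      rintro rfl
      exact hw.2 (by simpa using hr)
    · refine hdf n w ?_
      rintro rfl
      exact hw.1.2 (by simpa using hr.le)
  have hind : ∀ n : ℤ, ∀ R : ℝ, 0 < R → A R n = A 1 n := by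
    intro n R hR
    rcases le_total R 1 with h | h
    · exact (hle n R 1 hR h).symm
    · exact hle n 1 R one_pos h
  have hL : LauSeq (A 1) := by
    intro R hR
    have hcont : ContinuousOn f (Metric.sphere 0 R) := fun w hw =>
      (hf w (by rintro rfl; simp at hw; exact hR.ne hw)).continuousAt.continuousWithinAt
    obtain ⟨C, hC⟩ := (isCompact_sphere (0:ℂ) R).exists_bound_of_continuousOn hcont
    refine ⟨C, fun n => ?_⟩
    rw [← hind n R hR]
    have hb : ‖A R n‖ ≤ R * (R ^ (-n-1) * C) := by
      refine circleIntegral.norm_two_pi_i_inv_smul_integral_le_of_norm_le_const hR.le ?_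
      intro w hw
      rw [norm_mul, norm_zpow]
      have : ‖w‖ = R := by simpa using hw
      rw [this]
      gcongr
      exact hC w hw
    calc ‖A R n‖ * R ^ n ≤ (R * (R ^ (-n-1) * C)) * R ^ n := by gcongr
      _ = (R ^ (1:ℤ) * R ^ (-n-1) * R ^ n) * C := by rw [zpow_one]; ring
      _ = C := by
        rw [← zpow_add₀ hR.ne', ← zpow_add₀ hR.ne']
        simp
  refine ⟨A 1, hL, fun z hz => ?_⟩
  have hR : 0 < ‖z‖ := by simpa using hz
  set R := ‖z‖ with hRdef
  have : Fact (0 < 2 * Real.pi) := ⟨Real.two_pi_pos⟩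
  let F : C(AddCircle (2 * Real.pi), ℂ) :=
    ⟨fun x => f (R * (AddCircle.toCircle x : ℂ)), by
      refine continuous_iff_continuousAt.2 fun x => ?_
      have h1 : (R * (AddCircle.toCircle x : ℂ)) ≠ 0 := by simp [hz, R]
      refine ContinuousAt.comp (g := f) (hf _ h1).continuousAt ?_
      have := AddCircle.continuous_toCircle (T := 2 * Real.pi)
      fun_prop⟩
  have htc : ∀ x : ℝ, (AddCircle.toCircle (x : AddCircle (2 * Real.pi)) : ℂ) = exp (x * I) := by
    intro x
    rw [AddCircle.toCircle_apply_mk, Circle.coe_exp]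
    congr 2
    push_cast
    field_simp
  have hfc : ∀ n, fourierCoeff F n = A 1 n * (R:ℂ) ^ n := by
    intro n
    have hRc : (R:ℂ) ≠ 0 := by exact_mod_cast hR.ne'
    rw [← hind n R hR, fourierCoeff_eq_intervalIntegral F n 0]
    simp only [hA, circleIntegral, zero_add]
    have hpt : ∀ x : ℝ, deriv (circleMap 0 R) x • (circleMap 0 R x ^ (-n-1) * f (circleMap 0 R x))
        = (I * (R:ℂ) ^ (-n)) * (@fourier (2 * Real.pi) (-n) x • F x) := by
      intro x
      have he : exp (x * I) ≠ 0 := exp_ne_zero _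
      simp only [deriv_circleMap, smul_eq_mul, fourier_apply, AddCircle.toCircle_zsmul]
      change _ = _ * (_ * f (R * _))
      simp only [Circle.coe_zpow, htc, circleMap, zero_add]
      rw [mul_zpow, zpow_sub₀ hRc, zpow_sub₀ he]
      field_simp
    simp_rw [hpt]
    rw [intervalIntegral.integral_const_mul]
    rw [zpow_neg, smul_eq_mul]
    have hp : (Real.pi : ℂ) ≠ 0 := by exact_mod_cast Real.pi_ne_zero
    rw [Complex.real_smul]
    push_cast
    field_simp
  have hsum : Summable (fourierCoeff F) := by
    have : fourierCoeff F = fun n => A 1 n * (R:ℂ) ^ n := funext hfc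
    rw [this]
    exact (hL.hasSum _ (by exact_mod_cast hR.ne')).summable
  have hp := has_pointwise_sum_fourier_series_of_summable hsum ((z.arg : ℝ) : AddCircle (2 * Real.pi))
  have hz2 : (R:ℂ) * exp (z.arg * I) = z := norm_mul_exp_arg_mul_I z
  have hFz : F ((z.arg : ℝ) : AddCircle (2 * Real.pi)) = f z := by
    change f (R * _) = _
    rw [htc, hz2]
  rw [hFz] at hp
  refine hp.congr_fun ?_
  intro n
  rw [hfc, fourier_apply, AddCircle.toCircle_zsmul, Circle.coe_zpow, htc, smul_eq_mul, mul_assoc,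
    ← mul_zpow, hz2]

theorem LauSeq.sub {a b : ℤ → ℂ} (ha : LauSeq a) (hb : LauSeq b) : LauSeq (fun n => a n - b n) := by
  intro R hR
  obtain ⟨C, hC⟩ := ha R hR
  obtain ⟨D, hD⟩ := hb R hR
  refine ⟨C + D, fun n => ?_⟩
  calc ‖a n - b n‖ * R ^ n ≤ (‖a n‖ + ‖b n‖) * R ^ n := by gcongr; exact norm_sub_le _ _
    _ ≤ _ := by have := hC n; have := hD n; linarith

theorem LauSeq.shift {g : ℤ → ℂ} (hg : LauSeq g) (q l : ℂ) (hq : 0 < ‖q‖) (k : ℤ) :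
    LauSeq (fun n => l * q ^ (n + k) * g (n + k)) := by
  intro R hR
  obtain ⟨C, hC⟩ := hg (‖q‖ * R) (by positivity)
  refine ⟨‖l‖ * C * R ^ (-k), fun n => ?_⟩
  have := hC (n + k)
  calc ‖l * q ^ (n + k) * g (n + k)‖ * R ^ n
      = ‖l‖ * (‖g (n + k)‖ * (‖q‖ * R) ^ (n + k)) * R ^ (-k) := by
        rw [norm_mul, norm_mul, norm_zpow, mul_zpow, zpow_add₀ hR.ne', zpow_neg]
        field_simp
    _ ≤ _ := by gcongr

theorem hasSum_shift {g : ℤ → ℂ} {G : ℂ → ℂ}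
    (h : ∀ z : ℂ, z ≠ 0 → HasSum (fun n : ℤ => g n * z ^ n) (G z)) (q l : ℂ) (hq : q ≠ 0) (k : ℤ)
    (z : ℂ) (hz : z ≠ 0) :
    HasSum (fun n : ℤ => (l * q ^ (n + k) * g (n + k)) * z ^ n) (l * z ^ (-k) * G (q * z)) := by
  have h1 := (h (q * z) (mul_ne_zero hq hz)).mul_left (l * z ^ (-k))
  rw [← (Equiv.addRight k).hasSum_iff] at h1
  refine h1.congr_fun fun n => ?_
  simp only [Function.comp, Equiv.coe_addRight]
  rw [mul_zpow, zpow_add₀ hz, zpow_neg]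
  field_simp

theorem LauSeq.ent_pos {a : ℤ → ℂ} (ha : LauSeq a) (k : ℤ) : EntSeq (fun n => a (n + k)) := by
  intro R hR
  obtain ⟨C, hC⟩ := ha R hR
  refine ⟨C * R ^ (-k), fun n => ?_⟩
  have := hC (n + k)
  calc ‖a (n + k)‖ * R ^ n = ‖a (n + k)‖ * R ^ ((n:ℤ) + k) * R ^ (-k) := by
        rw [zpow_add₀ hR.ne', zpow_neg, zpow_natCast]; field_simp
    _ ≤ _ := by gcongr

theorem LauSeq.ent_neg {a : ℤ → ℂ} (ha : LauSeq a) (k : ℤ) : EntSeq (fun n => a (k - n)) := by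
  intro R hR
  obtain ⟨C, hC⟩ := ha R⁻¹ (by positivity)
  refine ⟨C * R ^ k, fun n => ?_⟩
  have := hC (k - n)
  calc ‖a (k - n)‖ * R ^ n = ‖a (k - n)‖ * R⁻¹ ^ (k - (n:ℤ)) * R ^ k := by
        rw [inv_zpow, zpow_sub₀ hR.ne', zpow_natCast]; field_simp
    _ ≤ _ := by gcongr

theorem EntSeq.smul {a : ℕ → ℂ} (ha : EntSeq a) (l q : ℂ) (hq : ‖q‖ ≤ 1) :
    EntSeq (fun n => l * q ^ n * a n) := by
  intro R hR
  obtain ⟨C, hC⟩ := ha R hR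
  refine ⟨‖l‖ * C, fun n => ?_⟩
  have h1 : ‖q‖ ^ n ≤ 1 := pow_le_one₀ (norm_nonneg _) hq
  have := hC n
  calc ‖l * q ^ n * a n‖ * R ^ n = ‖l‖ * (‖q‖ ^ n * (‖a n‖ * R ^ n)) := by
        rw [norm_mul, norm_mul, norm_pow]; ring
    _ ≤ ‖l‖ * (1 * (‖a n‖ * R ^ n)) := by gcongr
    _ ≤ _ := by rw [one_mul]; gcongr

theorem lau_glue {G H : ℕ → ℂ} (hG : EntSeq G) (hH : EntSeq H) (k : ℤ) :
    LauSeq (fun n => if k ≤ n then G (n - k).toNat else H (k - 1 - n).toNat) := by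
  intro R hR
  obtain ⟨C, hC⟩ := hG R hR
  obtain ⟨D, hD⟩ := hH R⁻¹ (by positivity)
  have hC0 : 0 ≤ C := le_trans (by positivity) (hC 0)
  have hD0 : 0 ≤ D := le_trans (by positivity) (hD 0)
  refine ⟨C * R ^ k + D * R ^ (k - 1), fun n => ?_⟩
  have p1 : 0 ≤ C * R ^ k := by positivity
  have p2 : 0 ≤ D * R ^ (k - 1) := by positivity
  dsimp only
  split_ifs with h
  · obtain ⟨m, hm⟩ : ∃ m : ℕ, n = m + k := ⟨(n - k).toNat, by omega⟩
    subst hm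
    have e : ((m:ℤ) + k - k).toNat = m := by simp
    rw [e, zpow_add₀ hR.ne', zpow_natCast, ← mul_assoc]
    have : ‖G m‖ * R ^ m * R ^ k ≤ C * R ^ k := by gcongr; exact hC m
    linarith
  · obtain ⟨m, hm⟩ : ∃ m : ℕ, n = k - 1 - m := ⟨(k - 1 - n).toNat, by omega⟩
    subst hm
    have e : (k - 1 - (k - 1 - (m:ℤ))).toNat = m := by simp
    rw [e, zpow_sub₀ hR.ne' (k-1), zpow_natCast]
    have : ‖H m‖ * R⁻¹ ^ m * R ^ (k-1) ≤ D * R ^ (k-1) := by gcongr; exact hD m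
    rw [inv_pow] at this
    have e2 : ‖H m‖ * (R ^ (k-1) / R ^ m) = ‖H m‖ * (R ^ m)⁻¹ * R ^ (k-1) := by
      rw [div_eq_mul_inv]; ring
    linarith

theorem seq_exists (q η : ℂ) (hq0 : 0 < ‖q‖) (hq1 : ‖q‖ < 1) (hη : η ≠ 0) (k : ℕ) (hk : 1 ≤ k)
    (f : ℤ → ℂ) (hf : LauSeq f) : ∃ g : ℤ → ℂ, LauSeq g ∧ ∀ n : ℤ, (n < 0 ∨ (k:ℤ) ≤ n) →
      f n + g n - η ^ (-(k:ℤ)) * q ^ (n + k) * g (n + k) = 0 := by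
  have hq : q ≠ 0 := by simpa using hq0
  obtain ⟨G, hG, hG2⟩ := ent_exists (η ^ (-(k:ℤ)) * q ^ (2 * k)) q hq1.le k hk _
    ((hf.ent_pos k).smul (-1) 1 (by simp))
  obtain ⟨H, hH, hH2⟩ := ent_exists (η ^ (k:ℤ) * q ^ (1 - (k:ℤ))) q hq1.le k hk _
    ((hf.ent_neg (-1)).smul (η ^ (k:ℤ) * q ^ (1 - (k:ℤ))) q hq1.le)
  refine ⟨_, lau_glue hG hH k, ?_⟩
  rintro n (hn | hn)
  · rw [if_neg (by omega), if_neg (by omega)]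
    obtain ⟨m, rfl⟩ : ∃ m : ℕ, n = -1 - m := ⟨(-1 - n).toNat, by omega⟩
    have e1 : ((k:ℤ) - 1 - (-1 - m)).toNat = m + k := by omega
    have e2 : ((k:ℤ) - 1 - (-1 - m + k)).toNat = m := by omega
    rw [e1, e2, hH2 m]
    have e3 : η ^ (-(k:ℤ)) * q ^ (-1 - (m:ℤ) + k) * (η ^ (k:ℤ) * q ^ (1 - (k:ℤ)) * q ^ m) = 1 := by
      rw [← zpow_natCast q m]
      calc _ = (η ^ (-(k:ℤ)) * η ^ (k:ℤ)) * (q ^ (-1 - (m:ℤ) + k) * q ^ (1 - (k:ℤ)) * q ^ (m:ℤ)) := by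
            ring
        _ = 1 := by
          rw [← zpow_add₀ hη, ← zpow_add₀ hq, ← zpow_add₀ hq]
          have : (-1 - (m:ℤ) + k + (1 - k) + m) = 0 := by ring
          rw [this]; simp
    linear_combination (-(f (-1 - m) + H (m+k))) * e3
  · rw [if_pos hn, if_pos (by omega)]
    obtain ⟨m, rfl⟩ : ∃ m : ℕ, n = m + k := ⟨(n - k).toNat, by omega⟩
    have e1 : ((m:ℤ) + k - k).toNat = m := by omega
    have e2 : ((m:ℤ) + k + k - k).toNat = m + k := by omega
    have e3 : q ^ ((m:ℤ) + k + k) = q ^ (2 * k) * q ^ m := by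
      rw [← pow_add, ← zpow_natCast]; congr 1; push_cast; ring
    rw [e1, e2, hG2 m, e3]
    simp only [one_pow]
    ring

theorem seq_unique (q η : ℂ) (hq0 : 0 < ‖q‖) (hq1 : ‖q‖ < 1) (hη : η ≠ 0) (k : ℕ) (hk : 1 ≤ k)
    (g : ℤ → ℂ) (hg : LauSeq g) (h : ∀ n : ℤ, (n < 0 ∨ (k:ℤ) ≤ n) →
      g n - η ^ (-(k:ℤ)) * q ^ (n + k) * g (n + k) = 0) (n : ℤ) : g n = 0 := by
  have hq : q ≠ 0 := by simpa using hq0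
  have h1 := ent_unique (η ^ (-(k:ℤ)) * q ^ (2 * k)) q hq1.le k hk _ (hg.ent_pos k) (by
    intro m
    have := h (m + k) (Or.inr (by omega))
    have e3 : q ^ ((m:ℤ) + k + k) = q ^ (2 * k) * q ^ m := by
      rw [← pow_add, ← zpow_natCast]; congr 1; push_cast; ring
    rw [e3] at this
    push_cast
    linear_combination this)
  have h2 := ent_unique (η ^ (k:ℤ) * q ^ (1 - (k:ℤ))) q hq1.le k hk _ (hg.ent_neg (k - 1)) (by
    intro m
    have := h (-1 - m) (Or.inl (by omega))
    have e3 : η ^ (-(k:ℤ)) * q ^ (-1 - (m:ℤ) + k) * (η ^ (k:ℤ) * q ^ (1 - (k:ℤ)) * q ^ m) = 1 := by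
      rw [← zpow_natCast q m]
      calc _ = (η ^ (-(k:ℤ)) * η ^ (k:ℤ)) * (q ^ (-1 - (m:ℤ) + k) * q ^ (1 - (k:ℤ)) * q ^ (m:ℤ)) := by
            ring
        _ = 1 := by
          rw [← zpow_add₀ hη, ← zpow_add₀ hq, ← zpow_add₀ hq]
          have : (-1 - (m:ℤ) + k + (1 - k) + m) = 0 := by ring
          rw [this]; simp
    have e4 : (k:ℤ) - 1 - ((m + k : ℕ) : ℤ) = -1 - m := by push_cast; ring
    have e5 : -1 - (m:ℤ) + k = k - 1 - m := by ring
    simp only [e4]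
    rw [e5] at this e3
    linear_combination (-g (k - 1 - m)) * e3 - (η ^ (k:ℤ) * q ^ (1 - (k:ℤ)) * q ^ m) * this)
  rcases lt_or_ge n k with hn | hn
  · have := h2 (k - 1 - n).toNat
    rwa [show (k:ℤ) - 1 - ((k - 1 - n).toNat : ℤ) = n by omega] at this
  · have := h1 (n - k).toNat
    rwa [show ((n - k).toNat : ℤ) + k = n by omega] at this

theorem hasSum_fin (k : ℕ) (d : ℤ → ℂ) (hd : ∀ n : ℤ, (n < 0 ∨ (k:ℤ) ≤ n) → d n = 0) (z : ℂ) :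
    HasSum (fun n : ℤ => d n * z ^ n) (∑ n : Fin k, d n * z ^ (n : ℤ)) := by
  have h := hasSum_sum_of_ne_finset_zero (f := fun n : ℤ => d n * z ^ n) (L := SummationFilter.unconditional ℤ)
    (s := Finset.univ.image (fun n : Fin k => ((n : ℕ) : ℤ))) (by
      intro b hb
      rw [hd b, zero_mul]
      by_contra hc
      push Not at hc
      exact hb (Finset.mem_image.2 ⟨⟨b.toNat, by omega⟩, Finset.mem_univ _, by simp; omega⟩))
  rwa [Finset.sum_image (by
    intro a _ b _ hab
    dsimp only at hab
    exact Fin.ext (by exact_mod_cast hab))] at h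

/-- For `0 < |q| < 1`, `η ≠ 0`, `k ≥ 1` and `f` holomorphic on `ℂ ∖ {0}`, there exist
scalars `c_0, …, c_{k−1}` and a function `g` holomorphic on `ℂ ∖ {0}`, unique (the `c_n`
uniquely, and `g` uniquely on `ℂ ∖ {0}`), such that
`f(z) = Σ_{n=0}^{k−1} c_n z^n + η^{−k} z^{−k} g(qz) − g(z)` for all `z ≠ 0`.
In particular the cokernel of `g ↦ (z ↦ η^{−k} z^{−k} g(qz) − g(z))` is `k`-dimensional
with basis the classes `[1], [z], …, [z^{k−1}]`. -/
theorem cokernel_basis (q η : ℂ) (hq0 : 0 < ‖q‖) (hq1 : ‖q‖ < 1)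
    (hη : η ≠ 0) (k : ℕ) (hk : 1 ≤ k) (f : ℂ → ℂ)
    (hf : ∀ z : ℂ, z ≠ 0 → DifferentiableAt ℂ f z) :
    ∃ (c : Fin k → ℂ) (g : ℂ → ℂ),
      ((∀ z : ℂ, z ≠ 0 → DifferentiableAt ℂ g z) ∧
        ∀ z : ℂ, z ≠ 0 →
          f z = (∑ n : Fin k, c n * z ^ (n : ℤ)) +
            η ^ (-(k : ℤ)) * z ^ (-(k : ℤ)) * g (q * z) - g z) ∧
      ∀ (c' : Fin k → ℂ) (g' : ℂ → ℂ),
        ((∀ z : ℂ, z ≠ 0 → DifferentiableAt ℂ g' z) ∧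
          ∀ z : ℂ, z ≠ 0 →
            f z = (∑ n : Fin k, c' n * z ^ (n : ℤ)) +
              η ^ (-(k : ℤ)) * z ^ (-(k : ℤ)) * g' (q * z) - g' z) →
        c' = c ∧ ∀ z : ℂ, z ≠ 0 → g' z = g z := by
  have hq : q ≠ 0 := by simpa using hq0
  obtain ⟨a, ha, haf⟩ := laurent_exists f hf
  obtain ⟨b, hb, hab⟩ := seq_exists q η hq0 hq1 hη k hk a ha
  set g : ℂ → ℂ := fun z => ∑' n : ℤ, b n * z ^ n with hg
  have hbg : ∀ z : ℂ, z ≠ 0 → HasSum (fun n : ℤ => b n * z ^ n) (g z) := fun z hz => hb.hasSum z hz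
  have hgd : ∀ z : ℂ, z ≠ 0 → DifferentiableAt ℂ g z := fun z hz => hb.differentiableAt z hz
  set e : ℤ → ℂ := fun n => a n + b n - η ^ (-(k:ℤ)) * q ^ (n + k) * b (n + k) with he
  have hfe : ∀ z : ℂ, z ≠ 0 → f z = (∑ n : Fin k, e n * z ^ (n : ℤ)) +
            η ^ (-(k : ℤ)) * z ^ (-(k : ℤ)) * g (q * z) - g z := by
    intro z hz
    have h1 := ((haf z hz).add (hbg z hz)).sub (hasSum_shift hbg q (η ^ (-(k:ℤ))) hq k z hz)
    have h2 := hasSum_fin k e hab z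
    have h3 := h2.unique (h1.congr_fun fun n => by simp only [he]; ring)
    rw [h3]; ring
  refine ⟨fun n => e n, g, ⟨hgd, hfe⟩, ?_⟩
  rintro c' g' ⟨hgd', hfe'⟩
  obtain ⟨u, hu, hug⟩ := laurent_exists (fun z => g' z - g z)
    (fun z hz => (hgd' z hz).sub (hgd z hz))
  set d : ℤ → ℂ := fun n => if h : 0 ≤ n ∧ n < k then c' ⟨n.toNat, by omega⟩ - e n else 0 with hd
  have hd0 : ∀ n : ℤ, (n < 0 ∨ (k:ℤ) ≤ n) → d n = 0 := by
    intro n hn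
    simp only [hd]
    rw [dif_neg (by omega)]
  have hdn : ∀ n : Fin k, d (n : ℕ) = c' n - e (n : ℕ) := by
    intro n
    simp only [hd]
    rw [dif_pos (by omega)]
    simp
  have hdL : LauSeq d := by
    intro R hR
    refine ⟨∑ n : Fin k, ‖d (n : ℕ)‖ * R ^ ((n : ℕ) : ℤ), fun n => ?_⟩
    by_cases hn : n < 0 ∨ (k:ℤ) ≤ n
    · rw [hd0 n hn, norm_zero, zero_mul]
      positivity
    · have := Finset.single_le_sum (f := fun n : Fin k => ‖d (n : ℕ)‖ * R ^ ((n : ℕ) : ℤ))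
        (fun i _ => by positivity) (Finset.mem_univ (⟨n.toNat, by omega⟩ : Fin k))
      simp only [Int.toNat_of_nonneg (show 0 ≤ n by omega)] at this
      exact this
  have hz0 := laurent_unique _ ((hu.sub (hu.shift q (η ^ (-(k:ℤ))) hq0 k)).sub hdL) (by
    intro z hz
    have h1 := ((hug z hz).sub (hasSum_shift hug q (η ^ (-(k:ℤ))) hq k z hz)).sub
      (hasSum_fin k d hd0 z)
    have h2 : (g' z - g z) - η ^ (-(k:ℤ)) * z ^ (-(k:ℤ)) * (g' (q * z) - g (q * z)) -
        (∑ n : Fin k, d n * z ^ (n : ℤ)) = 0 := by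
      have h3 := hfe z hz
      have h4 := hfe' z hz
      simp only [hdn, sub_mul, Finset.sum_sub_distrib]
      linear_combination h4 - h3
    rw [h2] at h1
    exact h1.congr_fun fun n => by ring)
  have hu0 := seq_unique q η hq0 hq1 hη k hk u hu (by
    intro n hn
    have := hz0 n
    rw [hd0 n hn, sub_zero] at this
    exact this)
  constructor
  · funext n
    have := hz0 (n : ℕ)
    rw [hdn, hu0, hu0] at this
    linear_combination -this
  · intro z hz
    have h1 := hug z hz
    simp only [hu0, zero_mul] at h1
    exact sub_eq_zero.1 (h1.unique hasSum_zero)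
end

section
/- Fix q ∈ ℂ with 0 < |q| < 1, η ∈ ℂ with η ≠ 0, an integer k ≥ 1, and n ∈ ℤ. For every function g : ℂ → ℂ holomorphic on ℂ∖{0} one has ∮_{|z|=1} ϑ^k_n(z,η) · (η^{−k} z^{−k} g(qz) − g(z)) · z^{−1} dz = 0, i.e. the constant Laurent coefficient of the product of ϑ^k_n(·,η) with any element of the image of the operator g ↦ (z ↦ η^{−k} z^{−k} g(qz) − g(z)) vanishes. Consequently the Serre pairing (ϑ, [f]) ↦ constant Laurent coefficient of ϑ·f is well defined on the cokernel of this operator. -/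
lemma thetaTerm_succ (q η : ℂ) (hq : q ≠ 0) (hη : η ≠ 0) (k n : ℤ) (z : ℂ) (hz : z ≠ 0) (l : ℤ) :
    thetaTerm q η k n z (l + 1) = (q ^ n * η ^ k * z ^ k) * (q ^ k) ^ l * thetaTerm q η k n z l := by
  unfold thetaTerm
  have h1 : k * ((l + 1) * (l + 1 - 1)) / 2 = k * (l * (l - 1)) / 2 + k * l := by
    rw [← Int.add_mul_ediv_right _ _ (by norm_num : (2:ℤ) ≠ 0)]
    congr 1; ring
  rw [h1, show (l + 1) * n = l * n + n by ring, show k * (l + 1) = k * l + k by ring,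
    show k * l + k + n = k * l + n + k by ring, zpow_add₀ hq, zpow_add₀ hq, zpow_add₀ hη,
    zpow_add₀ hz (k * l + n) k, ← zpow_mul q k l]
  ring

lemma thetaTerm_q (q η : ℂ) (hq : q ≠ 0) (hη : η ≠ 0) (k n : ℤ) (z : ℂ) (hz : z ≠ 0) (l : ℤ) :
    thetaTerm q η k n (q * z) l = η ^ (-k) * z ^ (-k) * thetaTerm q η k n z (l + 1) := by
  rw [thetaTerm_succ q η hq hη k n z hz l]
  unfold thetaTerm
  rw [mul_zpow, zpow_add₀ hq (k * l) n, ← zpow_mul q k l, zpow_neg, zpow_neg]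
  have := zpow_ne_zero k hη
  have := zpow_ne_zero k hz
  field_simp

lemma theta_q (q η : ℂ) (hq : q ≠ 0) (hη : η ≠ 0) (k n : ℤ) (z : ℂ) (hz : z ≠ 0) :
    theta q η k n (q * z) = η ^ (-k) * z ^ (-k) * theta q η k n z := by
  unfold theta
  simp_rw [thetaTerm_q q η hq hη k n z hz]
  rw [tsum_mul_left]
  congr 1
  exact (Equiv.addRight (1:ℤ)).tsum_eq (fun l => thetaTerm q η k n z l)

lemma thetaTerm_ne (q η : ℂ) (hq : q ≠ 0) (hη : η ≠ 0) (k n : ℤ) (z : ℂ) (hz : z ≠ 0) (l : ℤ) :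
    thetaTerm q η k n z l ≠ 0 := by
  unfold thetaTerm
  exact mul_ne_zero (mul_ne_zero (mul_ne_zero (zpow_ne_zero _ hq) (zpow_ne_zero _ hq))
    (zpow_ne_zero _ hη)) (zpow_ne_zero _ hz)

lemma norm_pow_lt (q : ℂ) (hq1 : ‖q‖ < 1) (k : ℤ) (hk : 1 ≤ k) : ‖q ^ k‖ < 1 := by
  obtain ⟨m, rfl⟩ := Int.eq_ofNat_of_zero_le (by omega : 0 ≤ k)
  simp only [Int.ofNat_eq_natCast, zpow_natCast, norm_pow]
  exact pow_lt_one₀ (norm_nonneg _) hq1 (by rintro rfl; norm_num at hk)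

lemma thetaTerm_summable (q η : ℂ) (hq : q ≠ 0) (hq1 : ‖q‖ < 1) (hη : η ≠ 0) (k n : ℤ)
    (hk : 1 ≤ k) (z : ℂ) (hz : z ≠ 0) : Summable (fun l => ‖thetaTerm q η k n z l‖) := by
  have hqk := norm_pow_lt q hq1 k hk
  have hc : q ^ n * η ^ k * z ^ k ≠ 0 :=
    mul_ne_zero (mul_ne_zero (zpow_ne_zero _ hq) (zpow_ne_zero _ hη)) (zpow_ne_zero _ hz)
  have hs := thetaTerm_succ q η hq hη k n z hz
  have hne := thetaTerm_ne q η hq hη k n z hz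
  have hQ : q ^ k ≠ 0 := zpow_ne_zero _ hq
  generalize q ^ n * η ^ k * z ^ k = c at hc hs
  generalize q ^ k = Q at hqk hs hQ
  generalize thetaTerm q η k n z = t at hs hne
  have hp : Filter.Tendsto (fun m : ℕ => ‖Q‖ ^ m) Filter.atTop (nhds 0) :=
    tendsto_pow_atTop_nhds_zero_of_lt_one (norm_nonneg _) hqk
  apply Summable.of_nat_of_neg
  · apply summable_of_ratio_test_tendsto_lt_one (l := 0) zero_lt_one
    · exact Filter.Eventually.of_forall fun m => by simpa using hne m
    · have := hp.const_mul ‖c‖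
      rw [mul_zero] at this
      refine this.congr fun m => ?_
      push_cast
      rw [hs m]
      have := norm_ne_zero_iff.2 (hne m)
      simp only [norm_mul, norm_norm, zpow_natCast, norm_pow]
      field_simp
  · apply summable_of_ratio_test_tendsto_lt_one (l := 0) zero_lt_one
    · exact Filter.Eventually.of_forall fun m => by simpa using hne (-m)
    · have := (hp.const_mul (‖c‖⁻¹ * ‖Q‖))
      rw [mul_zero] at this
      refine this.congr fun m => ?_
      have h := hs (-((m:ℤ) + 1))
      rw [show -((m:ℤ) + 1) + 1 = -m by ring] at h
      push_cast
      rw [h]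
      have h1 := norm_ne_zero_iff.2 (hne (-((m:ℤ)+1)))
      have h2 := norm_ne_zero_iff.2 hc
      have h3 := norm_ne_zero_iff.2 hQ
      simp only [norm_mul, norm_norm, zpow_neg, norm_inv, norm_zpow]
      rw [zpow_add₀ h3, zpow_natCast, zpow_one]
      field_simp

lemma zpow_le_add (r R x : ℝ) (hr : 0 < r) (h1 : r < x) (h2 : x < R) (m : ℤ) :
    x ^ m ≤ r ^ m + R ^ m := by
  have hx : 0 < x := hr.trans h1
  have hR : 0 < R := hx.trans h2
  have a1 := zpow_pos hr m
  have a2 := zpow_pos hR m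
  rcases le_total 0 m with h | h
  · have := zpow_le_zpow_left₀ h hx.le h2.le
    linarith
  · have : x ^ m ≤ r ^ m := by
      obtain ⟨j, rfl⟩ : ∃ j, m = -j := ⟨-m, by ring⟩
      rw [zpow_neg, zpow_neg]
      exact inv_anti₀ (zpow_pos hr j) (zpow_le_zpow_left₀ (by omega) hr.le h1.le)
    linarith

lemma theta_diff (q η : ℂ) (hq : q ≠ 0) (hq1 : ‖q‖ < 1) (hη : η ≠ 0) (k n : ℤ)
    (hk : 1 ≤ k) (z : ℂ) (hz : z ≠ 0) : DifferentiableAt ℂ (theta q η k n) z := by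
  have hz' : 0 < ‖z‖ := norm_pos_iff.2 hz
  set r := ‖z‖ / 2 with hr
  set R := ‖z‖ * 2 with hR
  have hr0 : 0 < r := by positivity
  have hR0 : 0 < R := by positivity
  let U : Set ℂ := {w | r < ‖w‖ ∧ ‖w‖ < R}
  have hU : IsOpen U := (isOpen_lt continuous_const continuous_norm).inter
    (isOpen_lt continuous_norm continuous_const)
  have hzU : z ∈ U := ⟨by simp only [hr]; linarith, by simp only [hR]; linarith⟩
  have hD : DifferentiableOn ℂ (fun w => ∑' l : ℤ, thetaTerm q η k n w l) U := by
    refine Complex.differentiableOn_tsum_of_summable_norm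
      ((thetaTerm_summable q η hq hq1 hη k n hk r (by exact_mod_cast hr0.ne')).add
        (thetaTerm_summable q η hq hq1 hη k n hk R (by exact_mod_cast hR0.ne'))) ?_ hU ?_
    · intro l w hw
      have hw0 : w ≠ 0 := norm_pos_iff.1 (hr0.trans hw.1)
      unfold thetaTerm
      exact ((differentiableAt_zpow.2 (Or.inl hw0)).const_mul _).differentiableWithinAt
    · intro l w hw
      unfold thetaTerm
      simp only [norm_mul _ (_ ^ (k * l + n))]
      rw [← mul_add]
      refine mul_le_mul_of_nonneg_left ?_ (norm_nonneg _)
      simp only [norm_zpow, Complex.norm_real, Real.norm_of_nonneg hr0.le,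
        Real.norm_of_nonneg hR0.le]
      exact zpow_le_add _ _ _ hr0 hw.1 hw.2 _
  exact hD.differentiableAt (hU.mem_nhds hzU)

lemma circle_rot (F : ℂ → ℂ) (q : ℂ) (hq : q ≠ 0) :
    (∮ z in C(0, 1), z⁻¹ * F (q * z)) = ∮ z in C(0, ‖q‖), z⁻¹ * F z := by
  have hn : (‖q‖ : ℂ) ≠ 0 := by exact_mod_cast norm_ne_zero_iff.2 hq
  have key : ∀ R : ℝ, R ≠ 0 → ∀ G : ℂ → ℂ, (∮ z in C(0, R), z⁻¹ * G z)
      = ∫ θ in (0:ℝ)..2 * Real.pi, Complex.I * G (circleMap 0 R θ) := by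
    intro R hR G
    unfold circleIntegral
    refine intervalIntegral.integral_congr fun θ _ => ?_
    have : circleMap 0 R θ ≠ 0 := circleMap_ne_center hR
    simp only [deriv_circleMap, smul_eq_mul]
    field_simp
  rw [key 1 one_ne_zero (fun z => F (q * z)), key ‖q‖ (norm_ne_zero_iff.2 hq) F]
  have h : ∀ θ : ℝ, q * circleMap 0 1 θ = circleMap 0 ‖q‖ (θ + q.arg) := by
    intro θ
    conv_lhs => rw [← Complex.norm_mul_exp_arg_mul_I q]
    simp only [circleMap, zero_add, Complex.ofReal_one, one_mul, Complex.ofReal_add, add_mul,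
      Complex.exp_add]
    ring
  simp_rw [h]
  rw [intervalIntegral.integral_comp_add_right
    (fun θ => Complex.I * F (circleMap 0 ‖q‖ θ)) q.arg]
  have hper : Function.Periodic (fun θ => Complex.I * F (circleMap 0 ‖q‖ θ)) (2 * Real.pi) := by
    intro θ
    simp only [periodic_circleMap 0 ‖q‖ θ]
  have := hper.intervalIntegral_add_eq q.arg 0
  rw [zero_add] at this ⊢
  rw [add_comm (2 * Real.pi), this]

/-- For `0 < |q| < 1`, `η ≠ 0`, `k ≥ 1`, `n ∈ ℤ`, and any `g` holomorphic on `ℂ ∖ {0}`,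
the constant Laurent coefficient of `ϑ^k_n(·,η)` times the coboundary
`z ↦ η^{−k} z^{−k} g(qz) − g(z)` vanishes: the Serre pairing is well defined on the
cokernel of the coboundary operator. -/
theorem serre_pairing_well_defined (q η : ℂ) (hq0 : 0 < ‖q‖) (hq1 : ‖q‖ < 1)
    (hη : η ≠ 0) (k : ℤ) (hk : 1 ≤ k) (n : ℤ) (g : ℂ → ℂ)
    (hg : ∀ z : ℂ, z ≠ 0 → DifferentiableAt ℂ g z) :
    (∮ z in C(0, 1),
      theta q η k n z * (η ^ (-k) * z ^ (-k) * g (q * z) - g z) * z⁻¹) = 0 := by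
  have hq : q ≠ 0 := norm_pos_iff.1 hq0
  let F : ℂ → ℂ := fun z => theta q η k n z * g z
  have hF : ∀ z, z ≠ 0 → DifferentiableAt ℂ F z := fun z hz =>
    (theta_diff q η hq hq1 hη k n hk z hz).mul (hg z hz)
  have hs : ∀ z ∈ Metric.sphere (0:ℂ) 1, z ≠ 0 := fun z hz h => by simp [h] at hz
  have e1 : (∮ z in C(0, 1),
      theta q η k n z * (η ^ (-k) * z ^ (-k) * g (q * z) - g z) * z⁻¹)
      = ∮ z in C(0, 1), (z⁻¹ * F (q * z) - z⁻¹ * F z) := by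
    refine circleIntegral.integral_congr zero_le_one fun z hz => ?_
    simp only [F]
    rw [theta_q q η hq hη k n z (hs z hz)]
    ring
  have c1 : CircleIntegrable (fun z => z⁻¹ * F (q * z)) 0 1 := by
    refine ContinuousOn.circleIntegrable zero_le_one fun z hz => ?_
    have hz := hs z hz
    refine ContinuousAt.continuousWithinAt ((continuousAt_inv₀ hz).mul ?_)
    exact ContinuousAt.comp (f := fun z => q * z) (hF (q * z) (mul_ne_zero hq hz)).continuousAt
      (by fun_prop)
  have c2 : CircleIntegrable (fun z => z⁻¹ * F z) 0 1 := by
    refine ContinuousOn.circleIntegrable zero_le_one fun z hz => ?_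
    have hz := hs z hz
    exact ContinuousAt.continuousWithinAt ((continuousAt_inv₀ hz).mul (hF z hz).continuousAt)
  rw [e1, circleIntegral.integral_sub c1 c2, circle_rot F q hq, sub_eq_zero]
  have hA := Complex.circleIntegral_sub_center_inv_smul_eq_of_differentiable_on_annulus_off_countable
    (c := 0) (f := F) hq0 hq1.le Set.countable_empty
    (fun z hz => (hF z (by
      rintro rfl
      exact hz.2 (by simpa using hq0))).continuousAt.continuousWithinAt)
    (fun z hz => hF z (by
      rintro rfl
      exact hz.1.2 (by simp)))
  simpa using hA.symm
end

section
/- Fix q ∈ ℂ with 0 < |q| < 1, η ∈ ℂ with η ≠ 0, an integer k ≥ 1, an integer n with 0 ≤ n ≤ 2k−1, and an integer l₀. Let c : ℤ → ℂ be such that the family l ↦ q^{nl} q^{kl²} η^{−2kl} c_{2kl+n}, indexed over l ∈ ℤ, is summable, and define c′ : ℤ → ℂ by c′_i = c_i + η^k·[i = l₀+k] − q^{l₀} η^{−k}·[i = l₀−k] (where [·] is 1 if the condition holds and 0 otherwise). Then the family l ↦ q^{nl} q^{kl²} η^{−2kl} c′_{2kl+n} is summable and Σ_{l∈ℤ} q^{nl}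 q^{kl²} η^{−2kl} c′_{2kl+n} = Σ_{l∈ℤ} q^{nl} q^{kl²} η^{−2kl} c_{2kl+n}. -/
/-- Invariance of the functional `θ^{2k}_n(c) = Σ_{l∈ℤ} q^{nl} q^{kl²} η^{−2kl} c_{2kl+n}`
under the `LN₋`-action replacing the coefficient sequence `c` by
`c′_i = c_i + η^k·[i = l₀+k] − q^{l₀} η^{−k}·[i = l₀−k]`. -/
theorem theta_functional_LN_invariant (q η : ℂ) (hq0 : 0 < ‖q‖) (hq1 : ‖q‖ < 1)
    (hη : η ≠ 0) (k : ℤ) (hk : 1 ≤ k) (n : ℤ) (hn0 : 0 ≤ n) (hn1 : n ≤ 2 * k - 1)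
    (l₀ : ℤ) (c : ℤ → ℂ)
    (hsum : Summable (fun l : ℤ => q ^ (n * l) * q ^ (k * l ^ 2) * η ^ (-(2 * k * l)) * c (2 * k * l + n)))
    (c' : ℤ → ℂ)
    (hc' : ∀ i : ℤ, c' i = c i + (if i = l₀ + k then η ^ k else 0)
      - (if i = l₀ - k then q ^ l₀ * η ^ (-k) else 0)) :
    Summable (fun l : ℤ =>
      q ^ (n * l) * q ^ (k * l ^ 2) * η ^ (-(2 * k * l)) * c' (2 * k * l + n)) ∧
    ∑' l : ℤ, q ^ (n * l) * q ^ (k * l ^ 2) * η ^ (-(2 * k * l)) * c' (2 * k * l + n)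
      = ∑' l : ℤ, q ^ (n * l) * q ^ (k * l ^ 2) * η ^ (-(2 * k * l)) * c (2 * k * l + n) := by
  have hq : q ≠ 0 := norm_pos_iff.mp hq0
  have hshift : ∀ (f : ℤ → ℂ) (s : ℂ), HasSum f s → HasSum (fun l => f (l + 1)) s := by
    intro f s h
    exact ((Equiv.addRight (1 : ℤ)).hasSum_iff (f := f) (a := s)).mpr h
  obtain ⟨g, hg⟩ : ∃ g : ℤ → ℂ, g = fun l => if 2 * k * l + n = l₀ + k then
    q ^ (n * l + k * l ^ 2) * η ^ (-(2 * k * l) + k) else 0 := ⟨_, rfl⟩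
  have hgs : Summable g := by
    apply summable_of_ne_finset_zero (s := {(l₀ + k - n) / (2 * k)})
    intro l hl
    simp only [hg]
    rw [if_neg]
    intro h
    apply hl
    rw [Finset.mem_singleton]
    have h2 : l₀ + k - n = 2 * k * l := by linarith
    rw [h2, Int.mul_ediv_cancel_left _ (by omega)]
  have h1 : HasSum (fun l => g (l + 1)) (∑' l, g l) :=
    hshift g _ hgs.hasSum
  have key : (fun l : ℤ =>
      q ^ (n * l) * q ^ (k * l ^ 2) * η ^ (-(2 * k * l)) * c' (2 * k * l + n)) =
      fun l => q ^ (n * l) * q ^ (k * l ^ 2) * η ^ (-(2 * k * l)) * c (2 * k * l + n)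
        + g l - g (l + 1) := by
    funext l
    have e1 : q ^ (n * l) * q ^ (k * l ^ 2) * η ^ (-(2 * k * l)) *
        (if 2 * k * l + n = l₀ + k then η ^ k else 0) = g l := by
      simp only [hg]
      split_ifs
      · rw [zpow_add₀ hq, zpow_add₀ hη]; ring
      · simp
    have e2 : q ^ (n * l) * q ^ (k * l ^ 2) * η ^ (-(2 * k * l)) *
        (if 2 * k * l + n = l₀ - k then q ^ l₀ * η ^ (-k) else 0) = g (l + 1) := by
      simp only [hg]
      by_cases h : 2 * k * l + n = l₀ - k
      · rw [if_pos h, if_pos (by linarith)]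
        have a1 : n * (l + 1) + k * (l + 1) ^ 2 = n * l + k * l ^ 2 + l₀ := by
          linear_combination h
        have a2 : -(2 * k * (l + 1)) + k = -(2 * k * l) + -k := by ring
        rw [a1, a2, zpow_add₀ hq, zpow_add₀ hq, zpow_add₀ hη]; ring
      · rw [if_neg h, if_neg (by intro h'; apply h; linarith)]; simp
    rw [hc', mul_sub, mul_add, e1, e2]
  have H := (hsum.hasSum.add hgs.hasSum).sub h1
  rw [add_sub_cancel_right] at H
  rw [key]
  exact ⟨H.summable, H.tsum_eq⟩
end
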